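/- arXiv:1301.2852 — 2 statements merged into one kernel-verified Lean document; each statement's English description precedes it below -/
import Mathlib

section
/- Let X be a separable real Banach space, let f : X → ℝ be quasiconvex and densely continuous, and let m ∈ ℝ be the topological essential infimum of f. If F_m‡ has empty interior (where F_m = {x ∈ X : f(x) < m}), then the set of points at which f is both continuous and Gâteaux differentiable is dense in X. If moreover X is reflexive and F_m‡ is contained in a Haar null set, then the set of points at which f fails to be continuous or fails to be Gâteaux differentiable is contained in a Haar null set. -/
open Filter Topology Set MeasureTheory

/-- `f` is quasiconvex: `f (l•x + (1-l)•y) ≤ max (f x) (f y)` for `l ∈ [0,1]`. -/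
def QuasiconvexFun {X : Type*} [AddCommGroup X] [Module ℝ X] (f : X → ℝ) : Prop :=
  ∀ x y : X, ∀ l : ℝ, l ∈ Set.Icc (0 : ℝ) 1 →
    f (l • x + (1 - l) • y) ≤ max (f x) (f y)

/-- `f` is strictly quasiconvex. -/
def StrictlyQuasiconvexFun {X : Type*} [AddCommGroup X] [Module ℝ X] (f : X → ℝ) : Prop :=
  ∀ x y : X, x ≠ y → ∀ l : ℝ, l ∈ Set.Ioo (0 : ℝ) 1 →
    f (l • x + (1 - l) • y) < max (f x) (f y)

/-- `f` is densely continuous: its set of points of continuity is dense. -/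
def DenselyContinuous {X : Type*} [TopologicalSpace X] (f : X → ℝ) : Prop :=
  Dense {x : X | ContinuousAt f x}

/-- `m` is the topological essential infimum of `f`: the strict sublevel set `{f < α}`
is meager for `α < m` and nonmeager for `α > m`. -/
def IsTopEssInf {X : Type*} [TopologicalSpace X] (f : X → ℝ) (m : ℝ) : Prop :=
  (∀ α : ℝ, α < m → IsMeagre {x : X | f x < α}) ∧
  (∀ α : ℝ, m < α → ¬ IsMeagre {x : X | f x < α})

/-- Aronszajn null set: a Borel set `N` such that for every sequence `ξ` with dense linear
span, `N` decomposes as a countable union of Borel sets, the `n`-th of which has Lebesgue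
null intersection with every line of direction `ξ n`. -/
def AronszajnNull {X : Type*} [NormedAddCommGroup X] [NormedSpace ℝ X]
    [MeasurableSpace X] (N : Set X) : Prop :=
  MeasurableSet N ∧
  ∀ ξ : ℕ → X, Dense (Submodule.span ℝ (Set.range ξ) : Set X) →
    ∃ Nn : ℕ → Set X, N = ⋃ n, Nn n ∧
      ∀ n, MeasurableSet (Nn n) ∧
        ∀ x : X, MeasureTheory.volume {t : ℝ | x + t • ξ n ∈ Nn n} = 0

/-- Haar null set: `E` is contained in a Borel set `B` for which there is a Borel
probability measure vanishing on all translates of `B`. -/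
def HaarNull {X : Type*} [AddCommGroup X] [TopologicalSpace X]
    [MeasurableSpace X] (E : Set X) : Prop :=
  ∃ B : Set X, E ⊆ B ∧ MeasurableSet B ∧
    ∃ μ : MeasureTheory.Measure X, MeasureTheory.IsProbabilityMeasure μ ∧
      ∀ x : X, μ ((fun y => x + y) '' B) = 0

/-- Hadamard differentiability of `f` at `x`. -/
def HadamardDiffAt {X : Type*} [NormedAddCommGroup X] [NormedSpace ℝ X]
    (f : X → ℝ) (x : X) : Prop :=
  ∃ L : X →L[ℝ] ℝ, ∀ h : X, ∀ t : ℕ → ℝ, (∀ n, t n ≠ 0) →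
    Tendsto t atTop (𝓝 0) → ∀ hs : ℕ → X, Tendsto hs atTop (𝓝 h) →
      Tendsto (fun n => (f (x + t n • hs n) - f x) / t n) atTop (𝓝 (L h))

/-- Hadamard differentiability at `x` of a function whose relevant values are those on `V`. -/
def HadamardDiffWithinAt {X : Type*} [NormedAddCommGroup X] [NormedSpace ℝ X]
    (f : X → ℝ) (V : Set X) (x : X) : Prop :=
  ∃ L : X →L[ℝ] ℝ, ∀ h : X, ∀ t : ℕ → ℝ, (∀ n, t n ≠ 0) →
    Tendsto t atTop (𝓝 0) → ∀ hs : ℕ → X, Tendsto hs atTop (𝓝 h) →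
      (∀ n, x + t n • hs n ∈ V) →
      Tendsto (fun n => (f (x + t n • hs n) - f x) / t n) atTop (𝓝 (L h))

/-- Gâteaux differentiability of `f` at `x` with derivative `L`. -/
def GateauxDiffAt {X : Type*} [NormedAddCommGroup X] [NormedSpace ℝ X]
    (f : X → ℝ) (x : X) (L : X →L[ℝ] ℝ) : Prop :=
  ∀ h : X, Tendsto (fun t : ℝ => (f (x + t • h) - f x) / t) (𝓝[≠] 0) (𝓝 (L h))

/-- Essential Gâteaux differentiability of `f` at `x`: directional derivatives exist and
are given by a continuous linear functional for a comeager (residual) set of directions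
in the unit sphere. -/
def EssGateauxDiffAt {X : Type*} [NormedAddCommGroup X] [NormedSpace ℝ X]
    (f : X → ℝ) (x : X) : Prop :=
  ∃ L : X →L[ℝ] ℝ, ∃ Ω : Set (Metric.sphere (0 : X) 1), IsMeagre Ωᶜ ∧
    ∀ h ∈ Ω, Tendsto (fun t : ℝ => (f (x + t • (h : X)) - f x) / t) (𝓝[≠] 0) (𝓝 (L (h : X)))

/-- `K` is a closed convex cone. -/
def IsClosedConvexCone {X : Type*} [NormedAddCommGroup X] [NormedSpace ℝ X] (K : Set X) : Prop :=
  IsClosed K ∧ Convex ℝ K ∧ ∀ l : ℝ, 0 ≤ l → ∀ k ∈ K, l • k ∈ K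

/-- `f` is `K`-nondecreasing on `U`. -/
def KNondecreasingOn {X : Type*} [AddCommGroup X] [Module ℝ X]
    (f : X → ℝ) (K U : Set X) : Prop :=
  ∀ u ∈ U, ∀ k ∈ K, k ≠ 0 → u + k ∈ U → f u ≤ f (u + k)

/-- Ideally convex subset: stable under infinite convex combinations of bounded sequences. -/
def IdeallyConvex {X : Type*} [NormedAddCommGroup X] [NormedSpace ℝ X] (C : Set X) : Prop :=
  ∀ (x : ℕ → X) (lam : ℕ → ℝ), (∀ n, x n ∈ C) → Bornology.IsBounded (Set.range x) →
    (∀ n, lam n ∈ Set.Icc (0 : ℝ) 1) → HasSum lam 1 →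
      ∑' n, lam n • x n ∈ C

/-- `C‡`: the union, over finite dimensional subspaces `Z ⊆ X`, of the closures of `C ∩ Z`. -/
def Ddag {X : Type*} [NormedAddCommGroup X] [NormedSpace ℝ X] (C : Set X) : Set X :=
  ⋃ (Z : Submodule ℝ X) (_ : FiniteDimensional ℝ Z), closure (C ∩ (Z : Set X))

/-- A normed space is reflexive if the canonical inclusion into its double dual is onto. -/
def IsReflexiveSpace (X : Type*) [NormedAddCommGroup X] [NormedSpace ℝ X] : Prop :=
  Function.Surjective (NormedSpace.inclusionInDoubleDual ℝ X)


/-- Resampling one coordinate preserves the infinite product measure. -/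
theorem update_pres17 {X : Type*} [MeasurableSpace X] (ν : ℕ → Measure X)
    [∀ k, IsProbabilityMeasure (ν k)] (k : ℕ) :
    Measure.map (fun p : X × (ℕ → X) => Function.update p.2 k p.1)
      ((ν k).prod (Measure.infinitePi ν)) = Measure.infinitePi ν := by
  classical
  have hmeas : Measurable (fun p : X × (ℕ → X) => Function.update p.2 k p.1) := by
    refine measurable_pi_lambda _ fun i => ?_
    by_cases h : i = k
    · subst h; simp only [Function.update_self]; exact measurable_fst
    · simp only [Function.update_of_ne h]; exact (measurable_pi_apply i).comp measurable_snd
  apply Measure.eq_infinitePi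
  intro s t ht
  rw [Measure.map_apply hmeas (MeasurableSet.pi s.countable_toSet (fun i _ => ht i))]
  have : (fun p : X × (ℕ → X) => Function.update p.2 k p.1) ⁻¹' (Set.pi s t)
      = (if k ∈ s then t k else univ) ×ˢ (Set.pi (s.erase k : Finset ℕ) t) := by
    ext ⟨y, ω⟩
    simp only [mem_preimage, Set.mem_pi, mem_prod]
    constructor
    · intro h
      refine ⟨?_, ?_⟩
      · split_ifs with hk
        · simpa using h k (by simpa using hk)
        · trivial
      · intro i hi
        simp at hi
        simpa [Function.update_of_ne hi.2] using h i (by simpa using hi.1)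
    · rintro ⟨h1, h2⟩ i hi
      by_cases hik : i = k
      · subst hik
        have : i ∈ s := by simpa using hi
        simpa [this] using h1
      · rw [Function.update_of_ne hik]
        exact h2 i (by simp [hik]; simpa using hi)
  rw [this, Measure.prod_prod, Measure.infinitePi_pi _ (fun i _ => ht i)]
  split_ifs with hk
  · rw [Finset.mul_prod_erase s (fun i => ν i (t i)) hk]
  · rw [Finset.erase_eq_of_notMem hk]; simp

theorem inf_conv17 {X : Type*} [NormedAddCommGroup X] [NormedSpace ℝ X] [CompleteSpace X]
    [SecondCountableTopology X] [MeasurableSpace X] [BorelSpace X]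
    (ν : ℕ → Measure X) [∀ k, IsProbabilityMeasure (ν k)]
    (hν : ∀ k, ∀ᵐ y ∂(ν k), ‖y‖ ≤ (1 / 2 : ℝ) ^ k) :
    ∃ μ : Measure X, IsProbabilityMeasure μ ∧ ∀ k, ∀ A : Set X, MeasurableSet A →
      ∀ c : ENNReal, (∀ x, ν k {y | x + y ∈ A} ≤ c) → ∀ x, μ {y | x + y ∈ A} ≤ c := by
  classical
  set P := Measure.infinitePi ν with hP
  let Y : ℕ → X → X := fun k p => if ‖p‖ ≤ (1 / 2 : ℝ) ^ k then p else 0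
  have hYm : ∀ k, Measurable (Y k) := fun k =>
    Measurable.ite (measurableSet_le measurable_norm measurable_const) measurable_id measurable_const
  have hYb : ∀ k p, ‖Y k p‖ ≤ (1 / 2 : ℝ) ^ k := by
    intro k p
    simp only [Y]
    split_ifs with h
    · exact h
    · simp
  have hY0 : ∀ k, Y k 0 = 0 := by intro k; simp [Y]
  let S : (ℕ → X) → X := fun ω => ∑' k, Y k (ω k)
  have hsum : ∀ ω : ℕ → X, Summable (fun k => Y k (ω k)) := fun ω =>
    Summable.of_norm_bounded summable_geometric_two (fun k => hYb k (ω k))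
  have hSm : Measurable S := by
    refine measurable_of_tendsto_metrizable (f := fun n ω => ∑ k ∈ Finset.range n, Y k (ω k)) ?_ ?_
    · intro n
      exact Finset.measurable_sum _ (fun k _ => (hYm k).comp (measurable_pi_apply k))
    · rw [tendsto_pi_nhds]
      intro ω
      exact (hsum ω).hasSum.tendsto_sum_nat
  have hSu : ∀ k ω y, S (Function.update ω k y) = S (Function.update ω k 0) + Y k y := by
    intro k ω y
    have h1 : ∀ z, S (Function.update ω k z) = Y k z + ∑' n, if n = k then 0 else Y n (ω n) := by
      intro z
      have := (hsum (Function.update ω k z)).tsum_eq_add_tsum_ite k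
      simp only [S]
      rw [this]
      simp only [Function.update_self]
      congr 1
      refine tsum_congr fun n => ?_
      split_ifs with h
      · rfl
      · rw [Function.update_of_ne h]
    rw [h1 y, h1 0, hY0]; abel
  refine ⟨Measure.map S P, Measure.isProbabilityMeasure_map hSm.aemeasurable, ?_⟩
  intro k A hA c hc x
  have hAx : ∀ z : X, MeasurableSet {y | z + y ∈ A} := fun z =>
    (measurable_const_add z) hA
  rw [Measure.map_apply hSm (hAx x)]
  have hmeas : Measurable (fun p : X × (ℕ → X) => Function.update p.2 k p.1) := by
    refine measurable_pi_lambda _ fun i => ?_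
    by_cases h : i = k
    · subst h; simp only [Function.update_self]; exact measurable_fst
    · simp only [Function.update_of_ne h]; exact (measurable_pi_apply i).comp measurable_snd
  rw [hP, ← update_pres17 ν k, Measure.map_apply hmeas (hSm (hAx x)),
    Measure.prod_apply_symm (hmeas (hSm (hAx x)))]
  calc ∫⁻ ω, ν k ((fun y => (y, ω)) ⁻¹' ((fun p : X × (ℕ → X) => Function.update p.2 k p.1) ⁻¹'
        (S ⁻¹' {y | x + y ∈ A}))) ∂(Measure.infinitePi ν)
      ≤ ∫⁻ _ω, c ∂(Measure.infinitePi ν) := by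
        refine lintegral_mono fun ω => ?_
        refine le_trans (measure_mono_ae ?_) (hc (x + S (Function.update ω k 0)))
        filter_upwards [hν k] with y hy hmem
        have h2 : x + S (Function.update ω k y) ∈ A := hmem
        rw [hSu] at h2
        have h3 : Y k y = y := by simp only [Y]; rw [if_pos hy]
        rw [h3, ← add_assoc] at h2
        exact h2
    _ = c := by simp

theorem haarNull_iff17 {X : Type*} [NormedAddCommGroup X] [NormedSpace ℝ X]
    [MeasurableSpace X] [BorelSpace X] {E : Set X} :
    HaarNull E ↔ ∃ B : Set X, E ⊆ B ∧ MeasurableSet B ∧ ∃ μ : Measure X,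
      IsProbabilityMeasure μ ∧ ∀ x, μ {y | x + y ∈ B} = 0 := by
  have key : ∀ (x : X) (B : Set X), (fun y => x + y) '' B = {y | -x + y ∈ B} := by
    intro x B; ext y; simp
  constructor
  · rintro ⟨B, h1, h2, μ, h3, h4⟩
    refine ⟨B, h1, h2, μ, h3, fun x => ?_⟩
    have := h4 (-x); rw [key, neg_neg] at this; exact this
  · rintro ⟨B, h1, h2, μ, h3, h4⟩
    refine ⟨B, h1, h2, μ, h3, fun x => ?_⟩
    rw [key]; exact h4 _

theorem HaarNull.mono17 {X : Type*} [NormedAddCommGroup X] [NormedSpace ℝ X]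
    [MeasurableSpace X] {E E' : Set X} (h : HaarNull E) (hs : E' ⊆ E) : HaarNull E' := by
  obtain ⟨B, h1, h2⟩ := h
  exact ⟨B, hs.trans h1, h2⟩

/-- localization of the measure -/
theorem localize17 {X : Type*} [NormedAddCommGroup X] [NormedSpace ℝ X]
    [SecondCountableTopology X] [MeasurableSpace X] [BorelSpace X]
    {B : Set X} (hB : MeasurableSet B) (μ : Measure X) [IsProbabilityMeasure μ]
    (h : ∀ x, μ {y | x + y ∈ B} = 0) (r : ℝ) (hr : 0 < r) :
    ∃ ν : Measure X, IsProbabilityMeasure ν ∧ (∀ᵐ y ∂ν, ‖y‖ ≤ r) ∧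
      ∀ x, ν {y | x + y ∈ B} = 0 := by
  have hex : ∃ z : X, μ (Metric.closedBall z r) ≠ 0 := by
    by_contra hcon
    push Not at hcon
    have : μ univ = 0 := by
      obtain ⟨s, hs, hs'⟩ := TopologicalSpace.isOpen_iUnion_countable
        (fun z : X => Metric.ball z r) (fun z => Metric.isOpen_ball)
      have hu : (⋃ z ∈ s, Metric.ball z r) = univ := by
        rw [hs']; exact iUnion_eq_univ_iff.2 fun z => ⟨z, Metric.mem_ball_self hr⟩
      rw [← hu, measure_biUnion_null_iff hs]
      exact fun z _ => measure_mono_null Metric.ball_subset_closedBall (hcon z)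
    simp at this
  obtain ⟨z, hz⟩ := hex
  have hm : Measurable (fun y : X => y - z) := measurable_id.sub_const z
  refine ⟨Measure.map (fun y => y - z) (ProbabilityTheory.cond μ (Metric.closedBall z r)), ?_, ?_, ?_⟩
  · have := ProbabilityTheory.cond_isProbabilityMeasure (μ := μ) hz
    exact Measure.isProbabilityMeasure_map hm.aemeasurable
  · rw [ae_map_iff hm.aemeasurable (measurableSet_le measurable_norm measurable_const)]
    filter_upwards [ProbabilityTheory.ae_cond_mem (μ := μ) Metric.isClosed_closedBall.measurableSet] with y hy
    simpa [dist_eq_norm] using hy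
  · intro x
    have hms : MeasurableSet {y | x + y ∈ B} := (measurable_const_add x) hB
    rw [Measure.map_apply hm hms]
    refine ProbabilityTheory.cond_absolutelyContinuous ?_
    convert h (x - z) using 2
    ext y; show x + (y - z) ∈ B ↔ x - z + y ∈ B; rw [show x + (y - z) = x - z + y by abel]

theorem HaarNull.iUnion17 {X : Type*} [NormedAddCommGroup X] [NormedSpace ℝ X] [CompleteSpace X]
    [SecondCountableTopology X] [MeasurableSpace X] [BorelSpace X]
    {E : ℕ → Set X} (h : ∀ n, HaarNull (E n)) : HaarNull (⋃ n, E n) := by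
  have h' := fun n => haarNull_iff17.1 (h n)
  choose B hEB hB μ hμ hμ0 using h'
  have h2 := fun n => localize17 (hB n) (μ n) (hμ0 n) ((1/2 : ℝ)^n) (by positivity)
  choose ν hν hνb hν0 using h2
  obtain ⟨μ', hμ', hk⟩ := inf_conv17 ν hνb
  refine haarNull_iff17.2 ⟨⋃ n, B n, iUnion_mono hEB, MeasurableSet.iUnion hB, μ', hμ', fun x => ?_⟩
  have : {y | x + y ∈ ⋃ n, B n} = ⋃ n, {y | x + y ∈ B n} := by ext y; simp
  rw [this, measure_iUnion_null_iff]
  intro n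
  have := hk n (B n) (hB n) 0 (fun x => (hν0 n x).le) x
  simpa using this

theorem HaarNull.empty17 {X : Type*} [NormedAddCommGroup X] [NormedSpace ℝ X]
    [MeasurableSpace X] : HaarNull (∅ : Set X) :=
  ⟨∅, subset_rfl, MeasurableSet.empty, Measure.dirac 0, inferInstance, by simp⟩

theorem HaarNull.union17 {X : Type*} [NormedAddCommGroup X] [NormedSpace ℝ X] [CompleteSpace X]
    [SecondCountableTopology X] [MeasurableSpace X] [BorelSpace X]
    {E E' : Set X} (h : HaarNull E) (h' : HaarNull E') : HaarNull (E ∪ E') := by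
  refine (HaarNull.iUnion17 (E := fun n => if n = 0 then E else E') ?_).mono17 ?_
  · intro n; by_cases hn : n = 0 <;> simp [hn, h, h']
  · rintro x (hx | hx)
    · exact mem_iUnion.2 ⟨0, by simpa using hx⟩
    · exact mem_iUnion.2 ⟨1, by simpa using hx⟩

theorem HaarNull.local17 {X : Type*} [NormedAddCommGroup X] [NormedSpace ℝ X] [CompleteSpace X]
    [SecondCountableTopology X] [MeasurableSpace X] [BorelSpace X]
    {E : Set X} (h : ∀ x ∈ E, ∃ U, IsOpen U ∧ x ∈ U ∧ HaarNull (E ∩ U)) : HaarNull E := by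
  choose! U hU hxU hN using h
  obtain ⟨s, hs, hs'⟩ := TopologicalSpace.isOpen_iUnion_countable
    (fun z : E => U z) (fun z => hU z z.2)
  have hcov : E ⊆ ⋃ z ∈ s, (E ∩ U z) := by
    intro x hx
    have : x ∈ ⋃ z ∈ s, U (z : X) := by
      rw [hs']; exact mem_iUnion.2 ⟨⟨x, hx⟩, hxU x hx⟩
    simp only [mem_iUnion] at this ⊢
    obtain ⟨z, hz, hzx⟩ := this
    exact ⟨z, hz, hx, hzx⟩
  rcases s.eq_empty_or_nonempty with rfl | hne
  · exact HaarNull.empty17.mono17 (by simpa using hcov)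
  · obtain ⟨g, hg⟩ := hs.exists_eq_range hne
    refine (HaarNull.iUnion17 (E := fun n => E ∩ U (g n)) (fun n => hN _ (g n).2)).mono17 ?_
    intro x hx
    have h4 := hcov hx
    rw [mem_iUnion₂] at h4
    obtain ⟨z, hz, hxz⟩ := h4
    rw [hg] at hz
    obtain ⟨n, rfl⟩ := hz
    exact mem_iUnion.2 ⟨n, hxz⟩

/-- Haar null sets have empty interior. -/
theorem HaarNull.not_open17 {X : Type*} [NormedAddCommGroup X] [NormedSpace ℝ X]
    [SecondCountableTopology X] [MeasurableSpace X] [BorelSpace X]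
    {E U : Set X} (h : HaarNull E) (hU : IsOpen U) (hne : U.Nonempty) : ¬ U ⊆ E := by
  intro hUE
  obtain ⟨B, hEB, hB, μ, hμ, h0⟩ := haarNull_iff17.1 h
  obtain ⟨u, hu⟩ := hne
  obtain ⟨s, hs, hs'⟩ := TopologicalSpace.isOpen_iUnion_countable
    (fun z : X => {y | z + y ∈ U}) (fun z => hU.preimage (continuous_const_add z))
  have hun : (⋃ z ∈ s, {y | z + y ∈ U}) = univ := by
    rw [hs']; exact iUnion_eq_univ_iff.2 fun z => ⟨u - z, by simpa using hu⟩
  have : μ univ = 0 := by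
    rw [← hun, measure_biUnion_null_iff hs]
    exact fun z _ => measure_mono_null (t := {y | z + y ∈ B}) (fun y (hy : z + y ∈ U) => hEB (hUE hy)) (h0 z)
  simp at this

theorem haarNull_of_measure17 {X T : Type*} [NormedAddCommGroup X] [NormedSpace ℝ X]
    [MeasurableSpace X] [BorelSpace X] [MeasurableSpace T]
    (P : Measure T) [IsProbabilityMeasure P] (L : T → X) (hL : Measurable L)
    {A : Set X} (hA : MeasurableSet A) (h : ∀ x, P {t | x + L t ∈ A} = 0) : HaarNull A := by
  refine haarNull_iff17.2 ⟨A, subset_rfl, hA, P.map L, Measure.isProbabilityMeasure_map hL.aemeasurable, ?_⟩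
  intro x
  have hms : MeasurableSet {y | x + y ∈ A} := (measurable_const_add x) hA
  rw [Measure.map_apply hL hms]
  exact h x

theorem haarNull_of_line17 {X : Type*} [NormedAddCommGroup X] [NormedSpace ℝ X]
    [MeasurableSpace X] [BorelSpace X] {A : Set X} (hA : MeasurableSet A) (e : X)
    (h : ∀ x, volume {t : ℝ | x + t • e ∈ A} = 0) : HaarNull A := by
  have : IsProbabilityMeasure (volume.restrict (Icc (0:ℝ) 1)) := ⟨by simp⟩
  refine haarNull_of_measure17 (volume.restrict (Icc (0:ℝ) 1)) (fun t : ℝ => t • e)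
    (Continuous.measurable (by fun_prop)) hA ?_
  intro x
  exact Measure.restrict_le_self.absolutelyContinuous (h x)


/-- Gâteaux differentiability from differentiability along the finite dimensional subspaces spanned
by a dense sequence. -/
theorem gateaux_of_dense17 {X : Type*} [NormedAddCommGroup X] [NormedSpace ℝ X]
    (g : X → ℝ) (K : NNReal) (hg : LipschitzWith K g) (x : X) (e : ℕ → X) (he : DenseRange e)
    (h : ∀ n : ℕ, DifferentiableAt ℝ (fun t : Fin n → ℝ => g (x + ∑ i, t i • e i)) 0) :
    ∃ L : X →L[ℝ] ℝ, GateauxDiffAt g x L := by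
  set q : X → ℝ → ℝ := fun v t => (g (x + t • v) - g x) / t with hq
  have hqd : ∀ v w t, t ≠ 0 → |q v t - q w t| ≤ K * ‖v - w‖ := by
    intro v w t ht
    have h1 : q v t - q w t = (g (x + t • v) - g (x + t • w)) / t := by
      simp only [hq]; ring
    rw [h1, abs_div, div_le_iff₀ (abs_pos.2 ht)]
    have h2 := hg.dist_le_mul (x + t • v) (x + t • w)
    rw [Real.dist_eq, dist_eq_norm] at h2
    have h3 : x + t • v - (x + t • w) = t • (v - w) := by rw [smul_sub]; abel
    rw [h3, norm_smul, Real.norm_eq_abs] at h2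
    linarith
  -- convergence for vectors in finite dimensional pieces
  have hfin : ∀ n : ℕ, ∃ M : (Fin n → ℝ) →L[ℝ] ℝ, ∀ s : Fin n → ℝ,
      Tendsto (q (∑ i, s i • e i)) (𝓝[≠] 0) (𝓝 (M s)) := by
    intro n
    refine ⟨fderiv ℝ (fun t : Fin n → ℝ => g (x + ∑ i, t i • e i)) 0, fun s => ?_⟩
    have h1 := ((h n).hasFDerivAt.hasLineDerivAt s).tendsto_slope_zero
    refine h1.congr fun t => ?_
    simp only [hq, zero_add, Pi.smul_apply, smul_eq_mul, Pi.zero_apply, zero_smul,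
      Finset.sum_const_zero, add_zero, Finset.smul_sum, smul_smul]
    rw [div_eq_inv_mul]
  have happ : ∀ v : X, ∀ ε > 0, ∃ k, ‖v - e k‖ < ε := by
    intro v ε hε
    obtain ⟨k, hk⟩ := he.exists_dist_lt v hε
    exact ⟨k, by rwa [← dist_eq_norm]⟩
  have hlim : ∀ v : X, ∃ l : ℝ, Tendsto (q v) (𝓝[≠] 0) (𝓝 l) := by
    intro v
    apply cauchy_map_iff_exists_tendsto.1
    rw [Metric.cauchy_iff]
    refine ⟨inferInstance, fun ε hε => ?_⟩
    obtain ⟨k, hk⟩ := happ v (ε / (4 * (K + 1))) (by positivity)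
    obtain ⟨M, hM⟩ := hfin (k + 1)
    have h1 := hM (Pi.single (Fin.last k) 1)
    have h2 : (∑ i : Fin (k+1), (Pi.single (Fin.last k) (1:ℝ) : Fin (k+1) → ℝ) i • e i) = e k := by
      rw [Finset.sum_eq_single (Fin.last k)]
      · simp
      · intro b _ hb; simp [hb]
      · simp
    rw [h2] at h1
    have h3 := (Metric.tendsto_nhds.1 h1) (ε / 4) (by positivity)
    have h4 : ∀ᶠ t : ℝ in 𝓝[≠] 0, t ≠ 0 := eventually_mem_nhdsWithin
    have hK : (K : ℝ) * ‖v - e k‖ < ε / 4 := by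
      have : (K : ℝ) * ‖v - e k‖ ≤ (K + 1) * ‖v - e k‖ := by
        nlinarith [norm_nonneg (v - e k)]
      have h5 : ((K : ℝ) + 1) * ‖v - e k‖ < (K + 1) * (ε / (4 * (K + 1))) := by
        apply mul_lt_mul_of_pos_left hk; positivity
      have h6 : ((K : ℝ) + 1) * (ε / (4 * (K + 1))) = ε / 4 := by field_simp
      linarith
    refine ⟨q v '' {t | dist (q (e k) t) (M (Pi.single (Fin.last k) 1)) < ε / 4 ∧ t ≠ 0},
      image_mem_map (h3.and h4), ?_⟩
    rintro _ ⟨t, ⟨ht, ht0⟩, rfl⟩ _ ⟨t', ⟨ht', ht0'⟩, rfl⟩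
    have a1 := hqd v (e k) t ht0
    have a2 := hqd v (e k) t' ht0'
    rw [Real.dist_eq] at ht ht' ⊢
    rw [abs_lt] at *
    rw [abs_le] at a1 a2
    constructor <;> linarith [ht.1, ht.2, ht'.1, ht'.2, a1.1, a1.2, a2.1, a2.2]
  choose ℓ hℓ using hlim
  have hadd : ∀ v w, ℓ (v + w) = ℓ v + ℓ w := by
    intro v w
    have hle : ∀ ε > 0, |ℓ (v + w) - (ℓ v + ℓ w)| ≤ ε := by
      intro ε hε
      set η := ε / (4 * (K + 1)) with hη
      have hηp : 0 < η := by positivity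
      have hKη : (K : ℝ) * η ≤ ε / 4 := by
        have h6 : ((K : ℝ) + 1) * η = ε / 4 := by rw [hη]; field_simp
        nlinarith
      obtain ⟨k, hk⟩ := happ v η hηp
      obtain ⟨j, hj⟩ := happ w η hηp
      obtain ⟨M, hM⟩ := hfin (k + j + 1)
      have hs : ∀ a : Fin (k + j + 1), (∑ i, (Pi.single a (1:ℝ) : Fin (k+j+1) → ℝ) i • e i) = e a := by
        intro a
        rw [Finset.sum_eq_single a]
        · simp
        · intro b _ hb; simp [hb]
        · simp
      let a : Fin (k + j + 1) := ⟨k, by omega⟩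
      let b : Fin (k + j + 1) := ⟨j, by omega⟩
      have t1 := hM (Pi.single a 1)
      have t2 := hM (Pi.single b 1)
      have t3 := hM (Pi.single a 1 + Pi.single b 1)
      rw [hs] at t1 t2
      have hs3 : (∑ i, ((Pi.single a (1:ℝ) : Fin (k+j+1) → ℝ) + (Pi.single b (1:ℝ) : Fin (k+j+1) → ℝ)) i • e i) = e k + e j := by
        simp only [Pi.add_apply, add_smul, Finset.sum_add_distrib]
        rw [hs, hs]
      rw [hs3, map_add] at t3
      have t4 : Tendsto (fun t => (q (v + w) t - q (e k + e j) t) - (q v t - q (e k) t) -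
          (q w t - q (e j) t)) (𝓝[≠] 0) (𝓝 ((ℓ (v + w) - (M (Pi.single a 1) + M (Pi.single b 1)))
            - (ℓ v - M (Pi.single a 1)) - (ℓ w - M (Pi.single b 1)))) :=
        (((hℓ (v + w)).sub t3).sub ((hℓ v).sub t1)).sub ((hℓ w).sub t2)
      have e1 : (ℓ (v + w) - (M (Pi.single a 1) + M (Pi.single b 1)))
            - (ℓ v - M (Pi.single a 1)) - (ℓ w - M (Pi.single b 1)) = ℓ (v + w) - (ℓ v + ℓ w) := by ring
      rw [e1] at t4
      refine le_of_tendsto t4.abs ?_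
      filter_upwards [eventually_mem_nhdsWithin] with t (ht : t ≠ 0)
      have c1 := hqd (v + w) (e k + e j) t ht
      have c2 := hqd v (e k) t ht
      have c3 := hqd w (e j) t ht
      have n1 : ‖v + w - (e k + e j)‖ ≤ ‖v - e k‖ + ‖w - e j‖ := by
        rw [add_sub_add_comm]; exact norm_add_le _ _
      have K0 : (0:ℝ) ≤ K := K.2
      have d1 : (K:ℝ) * ‖v + w - (e k + e j)‖ ≤ K * (2 * η) :=
        mul_le_mul_of_nonneg_left (by linarith) K0
      have d2 : (K:ℝ) * ‖v - e k‖ ≤ K * η := mul_le_mul_of_nonneg_left hk.le K0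
      have d3 : (K:ℝ) * ‖w - e j‖ ≤ K * η := mul_le_mul_of_nonneg_left hj.le K0
      rw [abs_le] at *
      constructor <;> linarith [c1.1, c1.2, c2.1, c2.2, c3.1, c3.2]
    have := le_of_forall_gt_imp_ge_of_dense (fun ε (hε : (0:ℝ) < ε) => hle ε hε)
    have h0 := abs_nonpos_iff.1 this
    linarith
  have hsmul : ∀ (c : ℝ) v, ℓ (c • v) = c * ℓ v := by
    intro c v
    by_cases hc : c = 0
    · subst hc
      rw [zero_smul, zero_mul]
      refine tendsto_nhds_unique (hℓ 0) ?_
      simp [hq]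
    · have t1 : Tendsto (fun t : ℝ => c * t) (𝓝[≠] 0) (𝓝[≠] 0) := by
        refine tendsto_nhdsWithin_iff.2 ⟨?_, ?_⟩
        · have : Tendsto (fun t : ℝ => c * t) (𝓝 0) (𝓝 (c * 0)) := tendsto_id.const_mul c
          rw [mul_zero] at this
          exact this.mono_left nhdsWithin_le_nhds
        · filter_upwards [eventually_mem_nhdsWithin] with t (ht : t ≠ 0)
          exact mul_ne_zero hc ht
      have t2 := ((hℓ v).comp t1).const_mul c
      refine tendsto_nhds_unique (hℓ (c • v)) (t2.congr' ?_)
      filter_upwards [eventually_mem_nhdsWithin] with t (ht : t ≠ 0)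
      simp only [hq, Function.comp, smul_smul]
      rw [mul_comm t c]
      field_simp
  have hbd : ∀ v, ‖ℓ v‖ ≤ K * ‖v‖ := by
    intro v
    refine le_of_tendsto (hℓ v).norm ?_
    filter_upwards [eventually_mem_nhdsWithin] with t (ht : t ≠ 0)
    have := hqd v 0 t ht
    rw [Real.norm_eq_abs]
    simpa [hq, -abs_div] using this
  refine ⟨LinearMap.mkContinuous ⟨⟨ℓ, hadd⟩, by intro c v; simpa using hsmul c v⟩ K hbd, ?_⟩
  intro v
  exact hℓ v

theorem lipschitz_gateaux17 {X : Type*} [NormedAddCommGroup X] [NormedSpace ℝ X] [CompleteSpace X]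
    [SecondCountableTopology X] [MeasurableSpace X] [BorelSpace X]
    (g : X → ℝ) (K : NNReal) (hg : LipschitzWith K g) :
    HaarNull {x | ¬ ∃ L : X →L[ℝ] ℝ, GateauxDiffAt g x L} := by
  let e := TopologicalSpace.denseSeq X
  have he : DenseRange e := TopologicalSpace.denseRange_denseSeq X
  let A : ℕ → Set X := fun n =>
    {x | ¬ DifferentiableAt ℝ (fun t : Fin n → ℝ => g (x + ∑ i, t i • e i)) 0}
  refine (HaarNull.iUnion17 (E := A) ?_).mono17 ?_
  · intro n
    have hAm : MeasurableSet (A n) := by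
      have h1 : Continuous (Function.uncurry
          (fun (x : X) (t : Fin n → ℝ) => g (x + ∑ i, t i • e i))) := by
        have := hg.continuous
        unfold Function.uncurry
        fun_prop
      have h2 := measurableSet_of_differentiableAt_with_param ℝ h1
      have h3 : Measurable (fun x : X => (x, (0 : Fin n → ℝ))) := by fun_prop
      exact (h3 h2).compl
    have hL : Continuous (fun t : Fin n → ℝ => ∑ i, t i • e i) := by fun_prop
    have : IsProbabilityMeasure (volume.restrict (Icc (0:Fin n → ℝ) 1)) :=
      ⟨by simp [Real.volume_Icc_pi]⟩
    refine haarNull_of_measure17 (volume.restrict (Icc (0:Fin n → ℝ) 1)) _ hL.measurable hAm ?_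
    intro x
    refine Measure.restrict_le_self.absolutelyContinuous ?_
    let T : (Fin n → ℝ) →L[ℝ] X := ∑ i, (ContinuousLinearMap.proj i : (Fin n → ℝ) →L[ℝ] ℝ).smulRight (e i)
    have hT : ∀ t, T t = ∑ i, t i • e i := by
      intro t; simp [T]
    have hlip : LipschitzWith (K * ‖T‖₊) (fun t => g (x + T t)) := by
      refine hg.comp ?_
      have h1 := T.lipschitz
      intro a b
      simpa using h1 a b
    have hae := hlip.ae_differentiableAt (μ := volume)
    rw [ae_iff] at hae
    refine measure_mono_null ?_ hae
    intro t ht hd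
    apply ht
    have h5 : (fun s : Fin n → ℝ => g (x + ∑ i, t i • e i + ∑ i, s i • e i)) =
        (fun s => g (x + T s)) ∘ (fun s => t + s) := by
      funext s; simp only [Function.comp]; rw [map_add, hT, hT, add_assoc]
    rw [h5]
    refine DifferentiableAt.comp _ (by simpa using hd) (by fun_prop)
  · intro x hx
    by_contra hcon
    apply hx
    refine gateaux_of_dense17 g K hg x e he fun n => ?_
    by_contra h1
    exact hcon (mem_iUnion.2 ⟨n, h1⟩)


/-- The boundary of a convex set with nonempty interior is Haar null. -/
theorem frontier_null17 {X : Type*} [NormedAddCommGroup X] [NormedSpace ℝ X] [CompleteSpace X]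
    [SecondCountableTopology X] [MeasurableSpace X] [BorelSpace X]
    (C : Set X) (hC : Convex ℝ C) (hne : (interior C).Nonempty) : HaarNull (frontier C) := by
  obtain ⟨y, hy⟩ := hne
  obtain ⟨ρ, hρ, hball⟩ := Metric.isOpen_iff.1 isOpen_interior y hy
  refine HaarNull.local17 fun z hz => ⟨Metric.ball z ρ, Metric.isOpen_ball, Metric.mem_ball_self hρ, ?_⟩
  refine haarNull_of_line17 (isClosed_frontier.measurableSet.inter Metric.isOpen_ball.measurableSet) (z - y) ?_
  intro x
  apply Set.Subsingleton.measure_zero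
  have key : ∀ s t : ℝ, x + s • (z - y) ∈ frontier C ∩ Metric.ball z ρ →
      x + t • (z - y) ∈ frontier C ∩ Metric.ball z ρ → ¬ s < t := by
    intro s t hs ht hst
    have h1 : x + s • (z - y) - (z - y) ∈ interior C := by
      apply hball
      have h := hs.2
      rw [Metric.mem_ball, dist_eq_norm] at h ⊢
      convert h using 2
      abel
    have h2 : x + t • (z - y) ∈ closure C := frontier_subset_closure ht.1
    have h3 := hC.openSegment_interior_closure_subset_interior h1 h2
    apply hs.1.2
    apply h3
    have hp : 0 < t - s + 1 := by linarith
    refine ⟨(t - s) / (t - s + 1), 1 / (t - s + 1), div_pos (by linarith) hp, by positivity, ?_, ?_⟩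
    · field_simp
    · have e1 : (t - s) / (t - s + 1) + 1 / (t - s + 1) = 1 := by field_simp
      have e2 : (t - s) / (t - s + 1) * (s - 1) + 1 / (t - s + 1) * t = s := by field_simp; ring
      calc ((t - s) / (t - s + 1)) • (x + s • (z - y) - (z - y)) + (1 / (t - s + 1)) • (x + t • (z - y))
          = ((t - s) / (t - s + 1) + 1 / (t - s + 1)) • x +
            ((t - s) / (t - s + 1) * (s - 1) + 1 / (t - s + 1) * t) • (z - y) := by module
        _ = x + s • (z - y) := by rw [e1, e2, one_smul]
  intro s hs t ht
  rcases lt_trichotomy s t with h | h | h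
  · exact (key s t hs ht h).elim
  · exact h
  · exact (key t s ht hs h).elim

/-- smallest Lipschitz majorant on a set where the function is bounded -/
theorem lip_majorant17 {X : Type*} [NormedAddCommGroup X] [NormedSpace ℝ X]
    (f : X → ℝ) (W : Set X) (hW : W.Nonempty) (M : ℝ) (hM : ∀ y ∈ W, f y ≤ M) (n : NNReal) :
    ∃ u : X → ℝ, LipschitzWith n u ∧ (∀ y ∈ W, f y ≤ u y) ∧
      ∀ x ∈ W, (∀ y ∈ W, f y - f x ≤ n * ‖y - x‖) → u x = f x := by
  let u : X → ℝ := fun x => sSup ((fun y => f y - n * ‖y - x‖) '' W)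
  have hbdd : ∀ x, BddAbove ((fun y => f y - n * ‖y - x‖) '' W) := by
    intro x
    refine ⟨M, ?_⟩
    rintro _ ⟨y, hy, rfl⟩
    have := hM y hy
    have : (0:ℝ) ≤ n * ‖y - x‖ := by positivity
    simp only; linarith
  refine ⟨u, ?_, ?_, ?_⟩
  · apply LipschitzWith.of_le_add_mul
    intro x x'
    apply csSup_le (hW.image _)
    rintro _ ⟨y, hy, rfl⟩
    have h1 : f y - n * ‖y - x'‖ ≤ u x' := le_csSup (hbdd x') ⟨y, hy, rfl⟩
    have h2 : ‖y - x'‖ ≤ ‖y - x‖ + ‖x - x'‖ := norm_sub_le_norm_sub_add_norm_sub y x x'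
    have h3 : (n:ℝ) * ‖y - x'‖ ≤ n * (‖y - x‖ + ‖x - x'‖) := mul_le_mul_of_nonneg_left h2 n.2
    rw [dist_eq_norm]
    simp only; linarith
  · intro y hy
    exact le_csSup (hbdd y) ⟨y, hy, by simp⟩
  · intro x hx h
    apply le_antisymm
    · apply csSup_le (hW.image _)
      rintro _ ⟨y, hy, rfl⟩
      simp only; linarith [h y hy]
    · exact le_csSup (hbdd x) ⟨x, hx, by simp⟩

/-- Sandwich lemma for Gâteaux differentiability. -/
theorem gateaux_sandwich17 {X : Type*} [NormedAddCommGroup X] [NormedSpace ℝ X]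
    (f u l : X → ℝ) (W : Set X) (hW : IsOpen W) (x : X) (hx : x ∈ W)
    (hu : ∀ y ∈ W, f y ≤ u y) (hl : ∀ y ∈ W, l y ≤ f y) (hux : u x = f x) (hlx : l x = f x)
    (Lu Ll : X →L[ℝ] ℝ) (hLu : GateauxDiffAt u x Lu) (hLl : GateauxDiffAt l x Ll) :
    GateauxDiffAt f x Lu := by
  have hev : ∀ h : X, ∀ᶠ t : ℝ in 𝓝 0, x + t • h ∈ W := by
    intro h
    have : ContinuousAt (fun t : ℝ => x + t • h) 0 := by fun_prop
    exact this.eventually_mem (hW.mem_nhds (by simpa using hx))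
  have hle : ∀ h, Ll h ≤ Lu h := by
    intro h
    have h1 := (hLl h).mono_left (nhdsWithin_mono (0:ℝ) (fun t (ht : 0 < t) => ht.ne') : 𝓝[>] (0:ℝ) ≤ 𝓝[≠] 0)
    have h2 := (hLu h).mono_left (nhdsWithin_mono (0:ℝ) (fun t (ht : 0 < t) => ht.ne') : 𝓝[>] (0:ℝ) ≤ 𝓝[≠] 0)
    refine le_of_tendsto_of_tendsto h1 h2 ?_
    filter_upwards [(hev h).filter_mono nhdsWithin_le_nhds, self_mem_nhdsWithin] with t ht (ht0 : 0 < t)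
    apply div_le_div_of_nonneg_right _ ht0.le
    linarith [hu _ ht, hl _ ht]
  have heq : ∀ h, Ll h = Lu h := by
    intro h
    apply le_antisymm (hle h)
    have := hle (-h)
    simp only [map_neg] at this
    linarith
  intro h
  have h1 := hLl h
  rw [heq h] at h1
  have h2 := hLu h
  rw [tendsto_order] at h1 h2 ⊢
  have hcmp : ∀ᶠ t : ℝ in 𝓝[≠] 0,
      (min ((l (x + t • h) - l x) / t) ((u (x + t • h) - u x) / t) ≤ (f (x + t • h) - f x) / t) ∧
      ((f (x + t • h) - f x) / t ≤ max ((l (x + t • h) - l x) / t) ((u (x + t • h) - u x) / t)) := by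
    filter_upwards [(hev h).filter_mono nhdsWithin_le_nhds, self_mem_nhdsWithin] with t ht (ht0 : t ≠ 0)
    have a := hu _ ht
    have b := hl _ ht
    rw [hux, hlx]
    rcases lt_or_gt_of_ne ht0 with hneg | hpos
    · exact ⟨min_le_of_right_le (div_le_div_of_nonpos_of_le hneg.le (by linarith)),
        le_max_of_le_left (div_le_div_of_nonpos_of_le hneg.le (by linarith))⟩
    · exact ⟨min_le_of_left_le (div_le_div_of_nonneg_right (by linarith) hpos.le),
        le_max_of_le_right (div_le_div_of_nonneg_right (by linarith) hpos.le)⟩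
  constructor
  · intro a ha
    filter_upwards [h1.1 a ha, h2.1 a ha, hcmp] with t h3 h4 h5
    exact lt_of_lt_of_le (lt_min h3 h4) h5.1
  · intro a ha
    filter_upwards [h1.2 a ha, h2.2 a ha, hcmp] with t h3 h4 h5
    exact lt_of_le_of_lt h5.2 (max_lt h3 h4)

theorem gateaux_neg17 {X : Type*} [NormedAddCommGroup X] [NormedSpace ℝ X]
    (f : X → ℝ) (x : X) (L : X →L[ℝ] ℝ) (h : GateauxDiffAt f x L) :
    GateauxDiffAt (fun y => - f y) x (-L) := by
  intro v
  refine ((h v).neg).congr fun t => ?_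
  ring


theorem mono_local17 {X : Type*} [NormedAddCommGroup X] [NormedSpace ℝ X] [CompleteSpace X]
    [SecondCountableTopology X] [MeasurableSpace X] [BorelSpace X]
    (f : X → ℝ) (e : X) (κ : ℝ) (hκ : 0 < κ) (x₀ : X) (ρ : ℝ) (hρ : 0 < ρ) (a M : ℝ)
    (hmono : ∀ u ∈ Metric.ball x₀ ρ, ∀ w : X, ∀ s : ℝ, 0 < s → ‖w - u - s • e‖ < s * κ → f u ≤ f w)
    (ha : ∀ u ∈ Metric.ball x₀ ρ, a ≤ f u) (hM : ∀ u ∈ Metric.ball x₀ ρ, f u ≤ M) :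
    HaarNull ({x | ¬ (ContinuousAt f x ∧ ∃ L : X →L[ℝ] ℝ, GateauxDiffAt f x L)} ∩
      Metric.ball x₀ ρ) := by
  set W := Metric.ball x₀ ρ with hWdef
  have hWo : IsOpen W := Metric.isOpen_ball
  have hWne : W.Nonempty := ⟨x₀, Metric.mem_ball_self hρ⟩
  let P : ℕ → Set X := fun n => {x | x ∈ W ∧ ∃ s : ℝ, 0 < s ∧ s < 1 / (n + 1) ∧
    n * s < f (x + (2 * s) • e) - f (x - (2 * s) • e)}
  let G : Set X := ⋂ n, interior (P n)
  -- G is Haar null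
  have hG : HaarNull G := by
    refine haarNull_of_line17 (MeasurableSet.iInter fun n => isOpen_interior.measurableSet) e ?_
    intro x
    let φ : ℝ → ℝ := fun t => f (x + t • e)
    let J : Set ℝ := {t | x + t • e ∈ W}
    have hJo : IsOpen J := hWo.preimage (by fun_prop)
    have hmonoJ : MonotoneOn φ J := by
      intro s hs t ht hst
      rcases hst.eq_or_lt with rfl | hlt
      · exact le_rfl
      · refine hmono _ hs _ (t - s) (by linarith) ?_
        have : x + t • e - (x + s • e) - (t - s) • e = 0 := by module
        rw [this, norm_zero]
        exact mul_pos (by linarith) hκ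
    have hae := hmonoJ.ae_differentiableWithinAt_of_mem
    rw [ae_iff] at hae
    refine measure_mono_null ?_ hae
    intro t ht hd
    have htG : ∀ n, x + t • e ∈ P n := fun n => interior_subset (mem_iInter.1 ht n)
    have htJ : t ∈ J := (htG 0).1
    have hdiff : DifferentiableAt ℝ φ t := (hd htJ).differentiableAt (hJo.mem_nhds htJ)
    obtain ⟨c, hc⟩ := hdiff.isBigO_sub.bound
    obtain ⟨δ, hδ, hball⟩ := Metric.eventually_nhds_iff.1 hc
    obtain ⟨n, hn⟩ := exists_nat_gt (max (4 * |c|) (2 / δ))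
    obtain ⟨-, s, hs, hsn, hlt⟩ := htG n
    have hn1 : 4 * |c| < n := lt_of_le_of_lt (le_max_left _ _) hn
    have hn2 : 2 / δ < n := lt_of_le_of_lt (le_max_right _ _) hn
    have hs2 : 2 * s < δ := by
      rw [div_lt_iff₀ hδ] at hn2
      rw [lt_div_iff₀ (by positivity)] at hsn
      nlinarith
    have b1 := hball (y := t + 2 * s) (by rw [Real.dist_eq]; simpa [abs_of_pos hs] using hs2)
    have b2 := hball (y := t - 2 * s) (by rw [Real.dist_eq]; simpa [abs_of_pos hs] using hs2)
    simp only [add_sub_cancel_left, sub_sub_cancel_left, Real.norm_eq_abs, abs_neg,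
      abs_of_pos (by positivity : 0 < 2 * s)] at b1 b2
    have e1 : x + t • e + (2 * s) • e = x + (t + 2 * s) • e := by module
    have e2 : x + t • e - (2 * s) • e = x + (t - 2 * s) • e := by module
    rw [e1, e2] at hlt
    change n * s < φ (t + 2 * s) - φ (t - 2 * s) at hlt
    rw [abs_le] at b1 b2
    have : (n : ℝ) * s < 4 * |c| * s := by nlinarith [le_abs_self c, b1.2, b2.1]
    nlinarith
  -- pointwise Lipschitz off G
  have hPL : ∀ x ∈ W, x ∉ G → ∃ N : ℕ, ∀ y ∈ W, |f y - f x| ≤ N * ‖y - x‖ := by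
    intro x hx hxG
    have : ∃ n, x ∉ interior (P n) := by
      by_contra hcon; push Not at hcon
      exact hxG (mem_iInter.2 hcon)
    obtain ⟨n, hn⟩ := this
    obtain ⟨r, hr, hrW⟩ := Metric.isOpen_iff.1 hWo x hx
    -- scale η: everything stays in the ball
    set η := min (1 / ((n:ℝ) + 1)) (r / (2 * ‖e‖ + κ + 1)) with hη
    have hηp : 0 < η := by
      refine lt_min (by positivity) (by positivity)
    have hηr : ∀ s, 0 < s → s < η → s * (2 * ‖e‖ + κ + 1) < r := by
      intro s hs hsη
      have := lt_of_lt_of_le hsη (min_le_right _ _)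
      rwa [lt_div_iff₀ (by positivity)] at this
    have hin : ∀ s, 0 < s → s < η → ∀ c : ℝ, |c| ≤ 2 → ∀ x', ‖x' - x‖ < s * κ → x' + (c * s) • e ∈ W := by
      intro s hs hsη c hc x' hx'
      apply hrW
      rw [Metric.mem_ball, dist_eq_norm]
      have h1 : x' + (c * s) • e - x = (x' - x) + (c * s) • e := by abel
      rw [h1]
      have h2 := norm_add_le (x' - x) ((c * s) • e)
      rw [norm_smul, Real.norm_eq_abs, abs_mul, abs_of_pos hs] at h2
      have h3 := hηr s hs hsη
      have h4 : |c| * s * ‖e‖ ≤ 2 * s * ‖e‖ := by gcongr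
      nlinarith
    have hest : ∀ s, 0 < s → s < η → f (x + s • e) - f (x - s • e) ≤ n * s := by
      intro s hs hsη
      by_contra hcon
      push Not at hcon
      apply hn
      rw [mem_interior]
      refine ⟨Metric.ball x (s * κ), ?_, Metric.isOpen_ball, Metric.mem_ball_self (by positivity)⟩
      intro x' hx'
      rw [Metric.mem_ball, dist_eq_norm] at hx'
      have hx'W : x' ∈ W := by simpa using hin s hs hsη 0 (by simp) x' hx'
      refine ⟨hx'W, s, hs, lt_of_lt_of_le hsη (min_le_left _ _), lt_of_lt_of_le hcon ?_⟩
      have m1 : f (x + s • e) ≤ f (x' + (2 * s) • e) := by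
        refine hmono _ ?_ _ s hs ?_
        · simpa using hin s hs hsη 1 (by simp) x (by simpa using by positivity)
        · have : x' + (2 * s) • e - (x + s • e) - s • e = x' - x := by module
          rwa [this]
      have m2 : f (x' - (2 * s) • e) ≤ f (x - s • e) := by
        refine hmono _ ?_ _ s hs ?_
        · have := hin s hs hsη (-2) (by simp) x' hx'
          have e1 : x' + (-2 * s) • e = x' - (2 * s) • e := by module
          rwa [e1] at this
        · have : x - s • e - (x' - (2 * s) • e) - s • e = x - x' := by module
          rw [this, norm_sub_rev]; exact hx'
      linarith
    obtain ⟨N, hN⟩ := exists_nat_ge (max (2 * n / κ) ((M - a) * (2 / (η * κ))))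
    have hN1 := (le_max_left _ _).trans hN
    have hN2 := (le_max_right _ _).trans hN
    refine ⟨N, fun y hy => ?_⟩
    rcases eq_or_ne y x with rfl | hne
    · simp
    have hd : 0 < ‖y - x‖ := norm_pos_iff.2 (sub_ne_zero.2 hne)
    by_cases hsmall : 2 * ‖y - x‖ / κ < η
    · set s := 2 * ‖y - x‖ / κ with hs
      have hsp : 0 < s := by positivity
      have hsκ : ‖y - x‖ < s * κ := by rw [hs]; field_simp; linarith
      have hxm : x - s • e ∈ W := by
        have := hin s hsp hsmall (-1) (by simp) x (by simpa using by positivity)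
        have e1 : x + (-1 * s) • e = x - s • e := by module
        rwa [e1] at this
      have k1 : f (x - s • e) ≤ f y := by
        refine hmono _ hxm _ s hsp ?_
        have : y - (x - s • e) - s • e = y - x := by module
        rwa [this]
      have k2 : f y ≤ f (x + s • e) := by
        refine hmono _ hy _ s hsp ?_
        have : x + s • e - y - s • e = x - y := by module
        rw [this, norm_sub_rev]; exact hsκ
      have k3 : f (x - s • e) ≤ f x := by
        refine hmono _ hxm _ s hsp ?_
        have : x - (x - s • e) - s • e = 0 := by module
        rw [this, norm_zero]; positivity
      have k4 : f x ≤ f (x + s • e) := by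
        refine hmono _ hx _ s hsp ?_
        have : x + s • e - x - s • e = 0 := by module
        rw [this, norm_zero]; positivity
      have k5 := hest s hsp hsmall
      have k6 : (n : ℝ) * s ≤ N * ‖y - x‖ := by
        have : (n : ℝ) * s = 2 * n / κ * ‖y - x‖ := by rw [hs]; ring
        rw [this]; gcongr
      rw [abs_le]; constructor <;> linarith
    · push Not at hsmall
      have h1 : |f y - f x| ≤ M - a := by
        rw [abs_le]; constructor <;> linarith [ha x hx, hM x hx, ha y hy, hM y hy]
      have h0 : 0 ≤ M - a := (abs_nonneg _).trans h1
      have h2 : 1 ≤ 2 / (η * κ) * ‖y - x‖ := by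
        have : 2 / (η * κ) * ‖y - x‖ = (2 * ‖y - x‖ / κ) / η := by field_simp
        rw [this, le_div_iff₀ hηp]; linarith
      calc |f y - f x| ≤ (M - a) * 1 := by linarith
        _ ≤ (M - a) * (2 / (η * κ) * ‖y - x‖) := by gcongr
        _ = (M - a) * (2 / (η * κ)) * ‖y - x‖ := by ring
        _ ≤ N * ‖y - x‖ := by gcongr
  -- Lipschitz majorants and minorants
  have hu := fun n : ℕ => lip_majorant17 f W hWne M hM n
  have hl := fun n : ℕ => lip_majorant17 (fun y => - f y) W hWne (-a)
    (fun y hy => neg_le_neg (ha y hy)) n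
  choose u hu1 hu2 hu3 using hu
  choose l hl1 hl2 hl3 using hl
  refine (HaarNull.union17 hG (HaarNull.union17
    (HaarNull.iUnion17 fun n => lipschitz_gateaux17 (u n) _ (hu1 n))
    (HaarNull.iUnion17 fun n => lipschitz_gateaux17 (l n) _ (hl1 n)))).mono17 ?_
  rintro x ⟨hbad, hx⟩
  by_contra hcon
  simp only [mem_union, not_or, mem_iUnion, not_exists] at hcon
  obtain ⟨hxG, hxu, hxl⟩ := hcon
  obtain ⟨N, hN⟩ := hPL x hx hxG
  have hxu' : ∃ L : X →L[ℝ] ℝ, GateauxDiffAt (u N) x L := by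
    by_contra h; exact hxu N (not_exists.1 h)
  have hxl' : ∃ L : X →L[ℝ] ℝ, GateauxDiffAt (l N) x L := by
    by_contra h; exact hxl N (not_exists.1 h)
  obtain ⟨Lu, hLu⟩ := hxu'
  obtain ⟨Ll, hLl⟩ := hxl'
  apply hbad
  refine ⟨?_, Lu, ?_⟩
  · rw [Metric.continuousAt_iff']
    intro ε hε
    have h1 : ContinuousAt (fun y => (N:ℝ) * ‖y - x‖) x := by fun_prop
    have h2 : ∀ᶠ y in 𝓝 x, (N:ℝ) * ‖y - x‖ < ε :=
      h1.eventually_lt continuousAt_const (by simpa using hε)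
    filter_upwards [h2, hWo.mem_nhds hx] with y hy hyW
    rw [Real.dist_eq]
    exact lt_of_le_of_lt (hN y hyW) hy
  · refine gateaux_sandwich17 f (u N) (fun y => - l N y) W hWo x hx (hu2 N) ?_ ?_ ?_ Lu (-Ll) hLu
      (gateaux_neg17 _ _ _ hLl)
    · intro y hy
      have := hl2 N y hy
      linarith
    · refine hu3 N x hx fun y hy => ?_
      have := hN y hy
      exact (le_abs_self _).trans (by simpa using this)
    · have := hl3 N x hx fun y hy => ?_
      · simp only [this, neg_neg]
      have := hN y hy
      have h4 := (neg_le_abs (f y - f x)).trans this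
      simp only [NNReal.coe_natCast]
      linarith

theorem quasi_local17 {X : Type*} [NormedAddCommGroup X] [NormedSpace ℝ X] [CompleteSpace X]
    [SecondCountableTopology X] [MeasurableSpace X] [BorelSpace X]
    (f : X → ℝ) (hq : QuasiconvexFun f) (α : ℝ) (hne : (interior {x | f x < α}).Nonempty)
    (x₀ : X) (hx₀ : x₀ ∉ closure {x | f x < α}) :
    ∃ U, IsOpen U ∧ x₀ ∈ U ∧ HaarNull
      ({x | ¬ (ContinuousAt f x ∧ ∃ L : X →L[ℝ] ℝ, GateauxDiffAt f x L)} ∩ U) := by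
  obtain ⟨y₀, hy₀⟩ := hne
  obtain ⟨r, hr, hrball⟩ := Metric.isOpen_iff.1 isOpen_interior y₀ hy₀
  obtain ⟨ρ', hρ', hρball⟩ := Metric.isOpen_iff.1 isClosed_closure.isOpen_compl x₀ hx₀
  set ρ := min ρ' (r / 2) with hρ
  have hρp : 0 < ρ := lt_min hρ' (by positivity)
  have hlow : ∀ u ∈ Metric.ball x₀ ρ, α ≤ f u := by
    intro u hu
    by_contra hcon
    push Not at hcon
    exact hρball (Metric.ball_subset_ball (min_le_left _ _) hu) (subset_closure hcon)
  have hmono : ∀ u ∈ Metric.ball x₀ ρ, ∀ w : X, ∀ s : ℝ, 0 < s →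
      ‖w - u - s • (x₀ - y₀)‖ < s * (r / 2) → f u ≤ f w := by
    intro u hu w s hs hw
    -- p = u - (w - u)/s lies in the ball around y₀
    set p := u - s⁻¹ • (w - u) with hp
    have hpball : p ∈ Metric.ball y₀ r := by
      rw [Metric.mem_ball, dist_eq_norm]
      have e1 : p - y₀ = (u - x₀) - s⁻¹ • (w - u - s • (x₀ - y₀)) := by
        rw [smul_sub s⁻¹ (w - u), smul_smul, inv_mul_cancel₀ hs.ne', one_smul, hp]
        abel
      rw [e1]
      have h1 := norm_sub_le (u - x₀) (s⁻¹ • (w - u - s • (x₀ - y₀)))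
      rw [norm_smul, Real.norm_eq_abs, abs_of_pos (inv_pos.2 hs)] at h1
      have h2 : s⁻¹ * ‖w - u - s • (x₀ - y₀)‖ < r / 2 := by
        rw [inv_mul_lt_iff₀ hs]; exact hw
      have h3 : ‖u - x₀‖ < r / 2 := by
        rw [Metric.mem_ball, dist_eq_norm] at hu
        exact lt_of_lt_of_le hu (min_le_right _ _)
      linarith
    have h7 : p ∈ {x : X | f x < α} := interior_subset (hrball hpball)
    have hfp : f p < α := h7
    have hs1 : 0 < 1 + s := by linarith
    have hseg := hq p w (s / (1 + s)) ⟨by positivity, by rw [div_le_one hs1]; linarith⟩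
    have e2 : (s / (1 + s)) • p + (1 - s / (1 + s)) • w = u := by
      have h5 : (1 - s / (1 + s)) = 1 / (1 + s) := by field_simp; ring
      have h6 : s / (1 + s) * s⁻¹ = 1 / (1 + s) := by field_simp
      rw [h5, hp, smul_sub, smul_smul, h6]
      calc (s / (1 + s)) • u - (1 / (1 + s)) • (w - u) + (1 / (1 + s)) • w
          = (s / (1 + s) + 1 / (1 + s)) • u := by module
        _ = u := by
          have : s / (1 + s) + 1 / (1 + s) = 1 := by field_simp; ring
          rw [this, one_smul]
    rw [e2] at hseg
    rcases le_max_iff.1 hseg with h | h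
    · linarith [hlow u hu]
    · exact h
  refine ⟨Metric.ball x₀ ρ, Metric.isOpen_ball, Metric.mem_ball_self hρp, ?_⟩
  refine mono_local17 f (x₀ - y₀) (r / 2) (by positivity) x₀ ρ hρp α (f (x₀ + (x₀ - y₀))) hmono hlow ?_
  intro u hu
  refine hmono u hu _ 1 one_pos ?_
  have e1 : x₀ + (x₀ - y₀) - u - (1:ℝ) • (x₀ - y₀) = x₀ - u := by rw [one_smul]; abel
  rw [e1, norm_sub_rev, one_mul]
  rw [Metric.mem_ball, dist_eq_norm] at hu
  exact lt_of_lt_of_le hu (min_le_right _ _)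


theorem weak_inter17 {X : Type*} [NormedAddCommGroup X] [NormedSpace ℝ X]
    (hR : IsReflexiveSpace X) (K : ℕ → Set X) (hanti : Antitone K) (hne : ∀ n, (K n).Nonempty)
    (hcl : ∀ n, IsClosed (K n)) (hcv : ∀ n, Convex ℝ (K n)) (R : ℝ)
    (hbd : ∀ x ∈ K 0, ‖x‖ ≤ R) : ∃ x, ∀ n, x ∈ K n := by
  choose s hs using hne
  have hs0 : ∀ n, ‖s n‖ ≤ R := fun n => hbd _ (hanti (Nat.zero_le n) (hs n))
  let j : ℕ → WeakDual ℝ (StrongDual ℝ X) := fun n =>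
    StrongDual.toWeakDual (NormedSpace.inclusionInDoubleDual ℝ X (s n))
  have hcomp := WeakDual.isCompact_closedBall (𝕜 := ℝ) (E := StrongDual ℝ X) 0 R
  have hj : ∀ n, j n ∈ WeakDual.toStrongDual ⁻¹' Metric.closedBall (0 : StrongDual ℝ (StrongDual ℝ X)) R := by
    intro n
    refine (mem_closedBall_zero_iff (E := StrongDual ℝ (StrongDual ℝ X))).2 ?_
    exact (NormedSpace.double_dual_bound ℝ X (s n)).trans (hs0 n)
  obtain ⟨Φ, -, hΦ⟩ := hcomp.exists_mapClusterPt (u := j) (f := atTop)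
    (Filter.le_principal_iff.2 (Filter.mem_map.2 (Filter.Eventually.of_forall hj)))
  obtain ⟨x, hx⟩ := hR (WeakDual.toStrongDual Φ)
  refine ⟨x, fun n => ?_⟩
  by_contra hxn
  obtain ⟨φ, u, h1, h2⟩ := geometric_hahn_banach_point_closed (hcv n) (hcl n) hxn
  have hΦφ : Φ φ = φ x := by
    have : (WeakDual.toStrongDual Φ) φ = φ x := by rw [← hx]; rfl
    exact this
  have hopen : IsOpen {Ψ : WeakDual ℝ (StrongDual ℝ X) | Ψ φ < u} :=
    isOpen_lt (WeakDual.eval_continuous φ) continuous_const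
  have hfr := hΦ.frequently (hopen.mem_nhds (show Φ φ < u by rw [hΦφ]; exact h1))
  obtain ⟨N, hN1, hN2⟩ := (hfr.and_eventually (eventually_ge_atTop n)).exists
  have h3 : φ (s N) < u := hN1
  have h4 := h2 (s N) (hanti hN2 (hs N))
  linarith

theorem ptak17 {K : Type*} [TopologicalSpace K] [CompactSpace K] [T2Space K]
    (p : ℕ → C(K, ℝ)) (h0 : ∀ n s, 0 ≤ p n s) (h1 : ∀ n s, p n s ≤ 1)
    (hlim : ∀ s, Tendsto (fun n => p n s) atTop (𝓝 0)) (δ : ℝ) (hδ : 0 < δ) :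
    ∃ g ∈ convexHull ℝ (Set.range p), ∀ s, g s < δ := by
  by_contra hcon
  push Not at hcon
  let U : Set C(K, ℝ) := {g | MapsTo g univ (Iio δ)}
  have hUo : IsOpen U := ContinuousMap.isOpen_setOfPred_mapsTo isCompact_univ isOpen_Iio
  have hUc : Convex ℝ U := by
    intro a ha b hb s t hs ht hst x hx
    have h2 := convex_Iio δ (ha hx) (hb hx) hs ht hst
    simpa using h2
  have hdisj : Disjoint U (convexHull ℝ (Set.range p)) := by
    rw [Set.disjoint_left]
    intro g hg hg2
    obtain ⟨s, hs⟩ := hcon g hg2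
    exact absurd (hg (mem_univ s)) (not_lt.2 hs)
  obtain ⟨Λ, u, hΛ1, hΛ2⟩ := geometric_hahn_banach_open hUc hUo (convex_convexHull ℝ _) hdisj
  have hu : 0 < u := by
    have := hΛ1 0 (fun x _ => by simpa using hδ)
    simpa using this
  have hpos : ∀ g : C(K, ℝ), (∀ s, 0 ≤ g s) → 0 ≤ Λ g := by
    intro g hg
    by_contra hneg
    push Not at hneg
    have := hΛ1 ((u / Λ g) • g) (fun x _ => by
      have h3 : (u / Λ g) * g x ≤ 0 :=
        mul_nonpos_of_nonpos_of_nonneg (div_nonpos_of_nonneg_of_nonpos hu.le hneg.le) (hg x)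
      have : (u / Λ g) * g x < δ := by linarith
      simpa using this)
    rw [map_smul, smul_eq_mul, div_mul_cancel₀ _ hneg.ne] at this
    exact lt_irrefl _ this
  letI : MeasurableSpace K := borel K
  haveI : BorelSpace K := ⟨rfl⟩
  let Λ0 : CompactlySupportedContinuousMap K ℝ →ₗ[ℝ] ℝ :=
    { toFun := fun g => Λ g.toContinuousMap
      map_add' := fun a b => map_add Λ a.toContinuousMap b.toContinuousMap
      map_smul' := fun c a => map_smul Λ c a.toContinuousMap }
  let Λ' : CompactlySupportedContinuousMap K ℝ →ₚ[ℝ] ℝ :=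
    PositiveLinearMap.mk₀ Λ0 (fun g hg => hpos g.toContinuousMap (fun s => hg s))
  let μ := RealRMK.rieszMeasure Λ'
  have hint : ∀ g : C(K, ℝ), ∫ x, g x ∂μ = Λ g := by
    intro g
    exact RealRMK.integral_rieszMeasure Λ' (CompactlySupportedContinuousMap.continuousMapEquiv g)
  have hfin : IsFiniteMeasure μ := by
    have : IsFiniteMeasureOnCompacts μ := inferInstance
    exact CompactSpace.isFiniteMeasure
  have hdc : Tendsto (fun n => ∫ x, p n x ∂μ) atTop (𝓝 (∫ x, (0:ℝ) ∂μ)) := by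
    refine tendsto_integral_of_dominated_convergence (fun _ => (1:ℝ)) ?_ (integrable_const _) ?_ ?_
    · intro n; exact (p n).continuous.aestronglyMeasurable
    · intro n; refine Eventually.of_forall fun s => ?_
      rw [Real.norm_of_nonneg (h0 n s)]; exact h1 n s
    · exact Eventually.of_forall hlim
  have hge : ∀ n, u ≤ ∫ x, p n x ∂μ := by
    intro n
    rw [hint]
    exact hΛ2 _ (subset_convexHull ℝ _ (mem_range_self n))
  have := ge_of_tendsto' hdc hge
  simp at this
  linarith


/-- Sweep of a set along the segment from `0` to `σ • z`. -/
def sweep17 {X : Type*} [NormedAddCommGroup X] [NormedSpace ℝ X] (D : Set X) (z : X) (σ : ℝ) :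
    Set X := {p | ∃ t ∈ Set.Icc (0:ℝ) σ, p - t • z ∈ D}

theorem sweep_closed17 {X : Type*} [NormedAddCommGroup X] [NormedSpace ℝ X] {D : Set X}
    (hD : IsClosed D) (z : X) (σ : ℝ) : IsClosed (sweep17 D z σ) := by
  have hk : IsCompact ((fun t : ℝ => t • z) '' Icc 0 σ) := isCompact_Icc.image (by fun_prop)
  have := hD.add_left_of_isCompact hk
  convert this using 1
  ext p
  rw [Set.mem_add]
  constructor
  · rintro ⟨t, ht, h⟩
    exact ⟨t • z, ⟨t, ht, rfl⟩, _, h, by abel⟩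
  · rintro ⟨_, ⟨t, ht, rfl⟩, d, hd, rfl⟩
    exact ⟨t, ht, by simpa using hd⟩

theorem sweep_convex17 {X : Type*} [NormedAddCommGroup X] [NormedSpace ℝ X] {D : Set X}
    (hD : Convex ℝ D) (z : X) (σ : ℝ) : Convex ℝ (sweep17 D z σ) := by
  rintro p ⟨t, ht, hp⟩ q ⟨s, hs, hq⟩ a b ha hb hab
  refine ⟨a * t + b * s, ?_, ?_⟩
  · have := convex_Icc (0:ℝ) σ ht hs ha hb hab
    simpa using this
  · have := hD hp hq ha hb hab
    convert this using 1
    module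

theorem sweep_interior_aux17 {X : Type*} [NormedAddCommGroup X] [NormedSpace ℝ X] {D : Set X}
    (hcv : Convex ℝ D) (hint : interior D = ∅) {z c : X} {s : ℝ} (hs : 0 < s)
    (hc : c ∈ D) (hc2 : c + s • z ∈ D) : interior (sweep17 D z s) = ∅ := by
  rw [Set.eq_empty_iff_forall_notMem]
  intro p hp
  have hopen : IsOpen ((fun q : X => (2:ℝ) • q - c) ⁻¹' interior (sweep17 D z s)) :=
    isOpen_interior.preimage (by fun_prop)
  have hsub : ((fun q : X => (2:ℝ) • q - c) ⁻¹' interior (sweep17 D z s)) ⊆ D := by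
    intro q hq
    obtain ⟨t, ht, hd⟩ := interior_subset hq
    have h1 : c + t • z ∈ D := by
      have := hcv hc hc2 (a := 1 - t / s) (b := t / s)
        (by rw [sub_nonneg, div_le_one hs]; exact ht.2) (div_nonneg ht.1 hs.le) (by ring)
      convert this using 1
      have : t • z = (t / s) • s • z := by rw [smul_smul, div_mul_cancel₀ _ hs.ne']
      rw [this]; module
    have := hcv hd h1 (a := 1/2) (b := 1/2) (by norm_num) (by norm_num) (by norm_num)
    convert this using 1
    module
  have hq : (1/2:ℝ) • (p + c) ∈ ((fun q : X => (2:ℝ) • q - c) ⁻¹' interior (sweep17 D z s)) := by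
    show (2:ℝ) • ((1/2:ℝ) • (p + c)) - c ∈ interior (sweep17 D z s)
    convert hp using 1
    module
  have := interior_maximal hsub hopen hq
  rw [hint] at this
  exact this

theorem sweep_double17 {X : Type*} [NormedAddCommGroup X] [NormedSpace ℝ X] {D : Set X}
    (hcl : IsClosed D) {z : X} {s : ℝ}
    (h : interior (sweep17 D z s) = ∅) : interior (sweep17 D z (2 * s)) = ∅ := by
  have hsub : sweep17 D z (2 * s) ⊆ sweep17 D z s ∪ (fun p => p - s • z) ⁻¹' sweep17 D z s := by
    rintro p ⟨t, ht, hp⟩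
    rcases le_total t s with h1 | h1
    · exact Or.inl ⟨t, ⟨ht.1, h1⟩, hp⟩
    · refine Or.inr ⟨t - s, ⟨by linarith, by linarith [ht.2]⟩, ?_⟩
      convert hp using 1
      module
  have h2 : interior ((fun p => p - s • z) ⁻¹' sweep17 D z s) = ∅ := by
    have := (Homeomorph.subRight (s • z)).preimage_interior (sweep17 D z s)
    rw [h, preimage_empty] at this
    exact this.symm
  have h3 := interior_union_isClosed_of_interior_empty (s := sweep17 D z s)
    (sweep_closed17 hcl z s) h2
  rw [h] at h3
  exact subset_empty_iff.1 (h3 ▸ interior_mono hsub)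

theorem sweep_interior17 {X : Type*} [NormedAddCommGroup X] [NormedSpace ℝ X] {D : Set X}
    (hcl : IsClosed D) (hcv : Convex ℝ D) (hint : interior D = ∅)
    (hchord : ∀ z : X, z ≠ 0 → ∃ c : X, ∃ s : ℝ, 0 < s ∧ c ∈ D ∧ c + s • z ∈ D) (z : X) :
    interior (sweep17 D z 1) = ∅ := by
  by_cases hz : z = 0
  · refine subset_empty_iff.1 (hint ▸ interior_mono ?_)
    rintro p ⟨t, -, hp⟩
    simpa [hz] using hp
  obtain ⟨c, s, hs, hc, hc2⟩ := hchord z hz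
  have h1 : ∀ n : ℕ, interior (sweep17 D z (2 ^ n * s)) = ∅ := by
    intro n
    induction n with
    | zero => simpa using sweep_interior_aux17 hcv hint hs hc hc2
    | succ n ih =>
      have := sweep_double17 hcl ih
      rw [pow_succ, mul_comm (2 ^ n) 2, mul_assoc]
      exact this
  obtain ⟨n, hn⟩ := pow_unbounded_of_one_lt (1 / s) (one_lt_two)
  refine subset_empty_iff.1 ((h1 n) ▸ interior_mono ?_)
  rintro p ⟨t, ht, hp⟩
  refine ⟨t, ⟨ht.1, ht.2.trans ?_⟩, hp⟩
  rw [div_lt_iff₀ hs] at hn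
  exact hn.le

/-- Existence of a point far from a closed convex set with empty interior. -/
theorem far_point17 {X : Type*} [NormedAddCommGroup X] [NormedSpace ℝ X] {D : Set X}
    (hcl : IsClosed D) (hcv : Convex ℝ D) (hint : interior D = ∅) (r : ℝ) (hr : 0 < r) :
    ∃ b : X, ‖b‖ ≤ r ∧ ∀ d ∈ D, r / 2 < ‖b - d‖ := by
  by_cases hne : D.Nonempty
  swap
  · refine ⟨0, by simpa using hr.le, fun d hd => absurd ⟨d, hd⟩ hne⟩
  have : ∃ p ∈ Metric.ball (0:X) (r/4), p ∉ D := by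
    by_contra hcon
    push Not at hcon
    have := interior_maximal hcon Metric.isOpen_ball (Metric.mem_ball_self (by positivity))
    rw [hint] at this
    exact this
  obtain ⟨p, hp, hpD⟩ := this
  rw [mem_ball_zero_iff] at hp
  obtain ⟨φ, u, h1, h2⟩ := geometric_hahn_banach_closed_point hcv hcl hpD
  have hφ : 0 < ‖φ‖ := by
    rw [norm_pos_iff]
    rintro rfl
    obtain ⟨d, hd⟩ := hne
    have := h1 d hd
    simp at this h2
    linarith
  obtain ⟨y, hy1, hy2⟩ : ∃ y : X, ‖y‖ < 1 ∧ 3/4 * ‖φ‖ < ‖φ y‖ := by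
    exact φ.exists_lt_apply_of_lt_opNorm (by linarith)
  obtain ⟨w, hw1, hw2⟩ : ∃ w : X, ‖w‖ < 1 ∧ 3/4 * ‖φ‖ < φ w := by
    rw [Real.norm_eq_abs] at hy2
    rcases lt_abs.1 hy2 with h | h
    · exact ⟨y, hy1, h⟩
    · exact ⟨-y, by simpa using hy1, by simpa using h⟩
  refine ⟨r • w, ?_, fun d hd => ?_⟩
  · rw [norm_smul, Real.norm_of_nonneg hr.le]
    nlinarith
  · have h3 : φ d < φ p := (h1 d hd).trans h2
    have h4 : φ p ≤ ‖φ‖ * ‖p‖ := (le_abs_self _).trans (φ.le_opNorm p)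
    have h5 : φ (r • w - d) ≤ ‖φ‖ * ‖r • w - d‖ := (le_abs_self _).trans (φ.le_opNorm _)
    rw [map_sub, map_smul, smul_eq_mul] at h5
    have h6 : r * (3/4 * ‖φ‖) < r * φ w := mul_lt_mul_of_pos_left hw2 hr
    have h7 : ‖φ‖ * ‖p‖ < ‖φ‖ * (r/4) := mul_lt_mul_of_pos_left hp hφ
    have h8 : ‖φ‖ * (r/2) < ‖φ‖ * ‖r • w - d‖ := by nlinarith
    exact lt_of_mul_lt_mul_left h8 hφ.le


theorem sweep_seq17 {X : Type*} [NormedAddCommGroup X] [NormedSpace ℝ X] {C : Set X}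
    (hcl : IsClosed C) (hcv : Convex ℝ C) (hint : interior C = ∅)
    (hchord : ∀ z : X, z ≠ 0 → ∃ c : X, ∃ s : ℝ, 0 < s ∧ c ∈ C ∧ c + s • z ∈ C) (x : ℕ → X) :
    ∃ D : ℕ → Set X, (∀ n, IsClosed (D n) ∧ Convex ℝ (D n) ∧ interior (D n) = ∅) ∧
      ∀ n i, i ≤ n → ∀ c ∈ C, c + x i ∈ D n := by
  let D : ℕ → Set X := fun n => Nat.rec (sweep17 C (x 0) 1) (fun n E => sweep17 E (x (n+1)) 1) n
  have hD0 : D 0 = sweep17 C (x 0) 1 := rfl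
  have hDs : ∀ n, D (n+1) = sweep17 (D n) (x (n+1)) 1 := fun n => rfl
  have hself : ∀ (E : Set X) z, E ⊆ sweep17 E z 1 := fun E z p hp =>
    ⟨0, ⟨le_refl _, zero_le_one⟩, by simpa using hp⟩
  have hadd : ∀ (E : Set X) z, ∀ p ∈ E, p + z ∈ sweep17 E z 1 := fun E z p hp =>
    ⟨1, ⟨zero_le_one, le_refl _⟩, by simpa using hp⟩
  have hCD : ∀ n, C ⊆ D n := by
    intro n
    induction n with
    | zero => exact hself _ _
    | succ n ih => exact ih.trans (hself _ _)
  refine ⟨D, ?_, ?_⟩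
  · intro n
    induction n with
    | zero =>
      exact ⟨sweep_closed17 hcl _ _, sweep_convex17 hcv _ _, sweep_interior17 hcl hcv hint hchord _⟩
    | succ n ih =>
      refine ⟨sweep_closed17 ih.1 _ _, sweep_convex17 ih.2.1 _ _,
        sweep_interior17 ih.1 ih.2.1 ih.2.2 (fun z hz => ?_) _⟩
      obtain ⟨c, s, h1, h2, h3⟩ := hchord z hz
      exact ⟨c, s, h1, hCD n h2, hCD n h3⟩
  · intro n
    induction n with
    | zero =>
      intro i hi c hc
      obtain rfl : i = 0 := by omega
      exact hadd _ _ _ hc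
    | succ n ih =>
      intro i hi c hc
      rcases Nat.lt_or_ge n i with h | h
      · obtain rfl : i = n + 1 := by omega
        exact hadd _ _ _ (hCD n hc)
      · exact hself _ _ (ih i h c hc)

theorem family_closed17 {X : Type*} [NormedAddCommGroup X] [NormedSpace ℝ X]
    (hR : IsReflexiveSpace X) {C : Set X}
    (hcl : IsClosed C) (hcv : Convex ℝ C) (R : ℝ) (hbd : ∀ c ∈ C, ‖c‖ ≤ R) (b : ℕ → X) :
    IsClosed {S : ℕ → Bool | ∃ x : X, ∀ n, S n = true → x + b n ∈ C} := by
  refine isClosed_of_closure_subset fun S hS => ?_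
  by_cases hall : ∃ n₀, S n₀ = true
  swap
  · exact ⟨0, fun n hn => absurd ⟨n, hn⟩ hall⟩
  obtain ⟨n₀, hn₀⟩ := hall
  let K : ℕ → Set X := fun N => {x | x + b n₀ ∈ C ∧ ∀ n < N, S n = true → x + b n ∈ C}
  have hbn : ∀ n, IsClosed {x | x + b n ∈ C} := fun n => hcl.preimage (continuous_add_const (b n))
  have hKcl : ∀ N, IsClosed (K N) := by
    intro N
    refine (hbn n₀).inter ?_
    have : {x : X | ∀ n < N, S n = true → x + b n ∈ C} =
      ⋂ (n : ℕ) (_ : n < N) (_ : S n = true), {x | x + b n ∈ C} := by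
      ext x; simp only [mem_iInter]; rfl
    show IsClosed {x : X | ∀ n < N, S n = true → x + b n ∈ C}
    rw [this]
    exact isClosed_iInter fun n => isClosed_iInter fun _ => isClosed_iInter fun _ => hbn n
  have hcomb : ∀ (x y v : X) (s t : ℝ), 0 ≤ s → 0 ≤ t → s + t = 1 → x + v ∈ C → y + v ∈ C →
      s • x + t • y + v ∈ C := by
    intro x y v s t hs ht hst hx hy
    have := hcv hx hy hs ht hst
    convert this using 1
    have : v = (s + t) • v := by rw [hst, one_smul]
    nth_rewrite 1 [this]
    module
  obtain ⟨x, hx⟩ := weak_inter17 hR K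
    (fun a b hab x hx => ⟨hx.1, fun n hn h => hx.2 n (lt_of_lt_of_le hn hab) h⟩)
    (by
      intro N
      let M := max N (n₀ + 1)
      have hopen : IsOpen (Set.pi (↑(Finset.range M)) (fun n => ({S n} : Set Bool))) :=
        isOpen_set_pi (Finset.finite_toSet _) (fun n _ => isOpen_discrete _)
      obtain ⟨T, hT, x, hx⟩ := mem_closure_iff.1 hS _ hopen (fun n _ => rfl)
      have hT' : ∀ n < M, T n = S n := fun n hn => hT n (by simpa using hn)
      refine ⟨x, hx n₀ ?_, fun n hn h => hx n ?_⟩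
      · rw [hT' n₀ (lt_of_lt_of_le (Nat.lt_succ_self _) (le_max_right _ _))]; exact hn₀
      · rw [hT' n (lt_of_lt_of_le hn (le_max_left _ _))]; exact h)
    hKcl
    (by
      intro N x hx y hy s t hs ht hst
      exact ⟨hcomb _ _ _ _ _ hs ht hst hx.1 hy.1, fun n hn h =>
        hcomb _ _ _ _ _ hs ht hst (hx.2 n hn h) (hy.2 n hn h)⟩)
    (R + ‖b n₀‖)
    (by
      intro x hx
      have h1 := hbd _ hx.1
      have h2 := norm_sub_le (x + b n₀) (b n₀)
      simp only [add_sub_cancel_right] at h2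
      linarith)
  exact ⟨x, fun n hn => (hx (n+1)).2 n (Nat.lt_succ_self n) hn⟩

theorem small_measure17 {X : Type*} [NormedAddCommGroup X] [NormedSpace ℝ X]
    [SecondCountableTopology X] [MeasurableSpace X] [BorelSpace X]
    (hR : IsReflexiveSpace X) {C : Set X}
    (hcl : IsClosed C) (hcv : Convex ℝ C) (hint : interior C = ∅) (R : ℝ) (hbd : ∀ c ∈ C, ‖c‖ ≤ R)
    (hchord : ∀ z : X, z ≠ 0 → ∃ c : X, ∃ s : ℝ, 0 < s ∧ c ∈ C ∧ c + s • z ∈ C)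
    (r δ : ℝ) (hr : 0 < r) (hδ : 0 < δ) :
    ∃ ν : Measure X, IsProbabilityMeasure ν ∧ (∀ᵐ y ∂ν, ‖y‖ ≤ r) ∧
      ∀ x, ν {y | x + y ∈ C} ≤ ENNReal.ofReal δ := by
  obtain ⟨D, hD, hCD⟩ := sweep_seq17 hcl hcv hint hchord (TopologicalSpace.denseSeq X)
  choose b hb1 hb2 using fun n => far_point17 (hD n).1 (hD n).2.1 (hD n).2.2 r hr
  have hfin : ∀ x, ∃ N, ∀ n ≥ N, x + b n ∉ C := by
    intro x
    obtain ⟨i, hi⟩ := (TopologicalSpace.denseRange_denseSeq X).exists_dist_lt (-x) (half_pos hr)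
    refine ⟨i, fun n hn hC => ?_⟩
    have h1 := hb2 n _ (hCD n i hn _ hC)
    rw [dist_eq_norm] at hi
    have h2 : b n - (x + b n + TopologicalSpace.denseSeq X i) = -x - TopologicalSpace.denseSeq X i := by
      abel
    rw [h2] at h1
    linarith
  let K : Set (ℕ → Bool) := {S | ∃ x : X, ∀ n, S n = true → x + b n ∈ C}
  have hKcl : IsClosed K := family_closed17 hR hcl hcv R hbd b
  haveI : CompactSpace K := isCompact_iff_compactSpace.1 hKcl.isCompact
  let p : ℕ → C(K, ℝ) := fun n =>
    ⟨fun S => if S.1 n = true then 1 else 0, by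
      have h1 : Continuous (fun t : Bool => if t = true then (1:ℝ) else 0) :=
        continuous_of_discreteTopology
      exact h1.comp ((continuous_apply n).comp continuous_subtype_val)⟩
  have hp : ∀ n S, p n S = if S.1 n = true then (1:ℝ) else 0 := fun n S => rfl
  obtain ⟨g, hg, hgδ⟩ := ptak17 p
    (fun n S => by rw [hp]; split_ifs <;> norm_num) (fun n S => by rw [hp]; split_ifs <;> norm_num)
    (fun S => by
      obtain ⟨x, hx⟩ := S.2
      obtain ⟨N, hN⟩ := hfin x
      refine tendsto_const_nhds.congr' ?_
      filter_upwards [eventually_ge_atTop N] with n hn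
      rw [hp, if_neg]
      exact fun h => hN n hn (hx n h)) δ hδ
  classical
  let Sx : X → K := fun x => ⟨fun n => decide (x + b n ∈ C), x, fun n hn => by simpa using hn⟩
  have hmeas : ∀ x : X, MeasurableSet {y | x + y ∈ C} := fun x =>
    (hcl.preimage (continuous_const_add x)).measurableSet
  let G : Set C(K, ℝ) := {g | (∀ x, 0 ≤ g (Sx x)) ∧ ∃ ν : Measure X, IsProbabilityMeasure ν ∧
    (∀ᵐ y ∂ν, ‖y‖ ≤ r) ∧ ∀ x, ν {y | x + y ∈ C} ≤ ENNReal.ofReal (g (Sx x))}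
  have hG : convexHull ℝ (Set.range p) ⊆ G := by
    refine convexHull_min ?_ ?_
    · rintro _ ⟨n, rfl⟩
      refine ⟨fun x => by rw [hp]; split_ifs <;> norm_num, Measure.dirac (b n), inferInstance, ?_, ?_⟩
      · rw [ae_dirac_iff (measurableSet_le measurable_norm measurable_const)]
        exact hb1 n
      · intro x
        rw [Measure.dirac_apply' _ (hmeas x), hp]
        by_cases h : x + b n ∈ C
        · have h1 : (Sx x).1 n = true := by simpa [Sx] using h
          rw [if_pos h1]
          simp only [ENNReal.ofReal_one]
          exact Set.indicator_le_self' (fun _ _ => zero_le) _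
        · have h1 : b n ∉ {y | x + y ∈ C} := h
          rw [Set.indicator_of_notMem h1]
          exact zero_le
    · rintro g₁ ⟨hg1, ν₁, hν₁, hn1, hm1⟩ g₂ ⟨hg2, ν₂, hν₂, hn2, hm2⟩ s t hs ht hst
      refine ⟨fun x => ?_, ENNReal.ofReal s • ν₁ + ENNReal.ofReal t • ν₂, ⟨?_⟩, ?_, fun x => ?_⟩
      · simpa using add_nonneg (mul_nonneg hs (hg1 x)) (mul_nonneg ht (hg2 x))
      · simp only [Measure.add_apply, Measure.smul_apply, smul_eq_mul, measure_univ, mul_one]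
        rw [← ENNReal.ofReal_add hs ht, hst, ENNReal.ofReal_one]
      · rw [ae_add_measure_iff]
        exact ⟨Measure.ae_smul_measure hn1 _, Measure.ae_smul_measure hn2 _⟩
      · have h3 : (s • g₁ + t • g₂) (Sx x) = s * g₁ (Sx x) + t * g₂ (Sx x) := by simp
        rw [h3, ENNReal.ofReal_add (mul_nonneg hs (hg1 x)) (mul_nonneg ht (hg2 x)),
          ENNReal.ofReal_mul hs, ENNReal.ofReal_mul ht]
        simp only [Measure.add_apply, Measure.smul_apply, smul_eq_mul]
        gcongr
        · exact hm1 x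
        · exact hm2 x
  obtain ⟨-, ν, h1, h2, h3⟩ := hG hg
  exact ⟨ν, h1, h2, fun x => (h3 x).trans (ENNReal.ofReal_le_ofReal (hgδ _).le)⟩


theorem matouskova_bdd17 {X : Type*} [NormedAddCommGroup X] [NormedSpace ℝ X] [CompleteSpace X]
    [SecondCountableTopology X] [MeasurableSpace X] [BorelSpace X]
    (hR : IsReflexiveSpace X) {C : Set X}
    (hcl : IsClosed C) (hcv : Convex ℝ C) (hint : interior C = ∅) (R : ℝ) (hbd : ∀ c ∈ C, ‖c‖ ≤ R) :
    HaarNull C := by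
  by_cases hchord : ∀ z : X, z ≠ 0 → ∃ c : X, ∃ s : ℝ, 0 < s ∧ c ∈ C ∧ c + s • z ∈ C
  · have hk1 : ∀ k : ℕ, (0:ℝ) < (1/2) ^ k := fun k => by positivity
    have hk2 : ∀ k : ℕ, (0:ℝ) < 1 / ((k:ℝ) + 1) := fun k => by positivity
    choose ν hν1 hν2 hν3 using fun k : ℕ =>
      small_measure17 hR hcl hcv hint R hbd hchord _ _ (hk1 k) (hk2 k)
    obtain ⟨μ, hμ, h⟩ := inf_conv17 ν hν2
    refine haarNull_iff17.2 ⟨C, subset_rfl, hcl.measurableSet, μ, hμ, fun x => ?_⟩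
    have h1 : ∀ k : ℕ, μ {y | x + y ∈ C} ≤ ENNReal.ofReal (1 / ((k:ℝ) + 1)) := fun k =>
      h k C hcl.measurableSet _ (hν3 k) x
    have h2 : Tendsto (fun k : ℕ => ENNReal.ofReal (1 / ((k:ℝ) + 1))) atTop (𝓝 0) := by
      have := ENNReal.tendsto_ofReal (tendsto_one_div_add_atTop_nhds_zero_nat (𝕜 := ℝ))
      simpa using this
    exact le_antisymm (ge_of_tendsto' h2 h1) zero_le
  · push Not at hchord
    obtain ⟨z, hz, h⟩ := hchord
    refine haarNull_of_line17 hcl.measurableSet z fun x => ?_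
    refine Set.Subsingleton.measure_zero ?_ _
    have key : ∀ t t' : ℝ, x + t • z ∈ C → x + t' • z ∈ C → ¬ t < t' := by
      intro t t' ht ht' hlt
      refine h _ (t' - t) (by linarith) ht ?_
      convert ht' using 1
      module
    intro t ht t' ht'
    exact le_antisymm (not_lt.1 (key _ _ ht' ht)) (not_lt.1 (key _ _ ht ht'))

theorem matouskova17 {X : Type*} [NormedAddCommGroup X] [NormedSpace ℝ X] [CompleteSpace X]
    [SecondCountableTopology X] [MeasurableSpace X] [BorelSpace X]
    (hR : IsReflexiveSpace X) {C : Set X}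
    (hcl : IsClosed C) (hcv : Convex ℝ C) (hint : interior C = ∅) : HaarNull C := by
  have h : ∀ n : ℕ, HaarNull (C ∩ Metric.closedBall 0 (n:ℝ)) := fun n =>
    matouskova_bdd17 hR (hcl.inter Metric.isClosed_closedBall)
      (hcv.inter (convex_closedBall _ _))
      (subset_empty_iff.1 (hint ▸ interior_mono inter_subset_left)) n
      (fun c hc => mem_closedBall_zero_iff.1 hc.2)
  refine (HaarNull.iUnion17 h).mono17 fun x hx => ?_
  obtain ⟨n, hn⟩ := exists_nat_ge ‖x‖
  exact mem_iUnion.2 ⟨n, hx, mem_closedBall_zero_iff.2 hn⟩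


theorem sublevel_convex17 {X : Type*} [NormedAddCommGroup X] [NormedSpace ℝ X]
    {f : X → ℝ} (hq : QuasiconvexFun f) (α : ℝ) : Convex ℝ {x : X | f x < α} := by
  intro x hx y hy a b ha hb hab
  have h := hq x y a ⟨ha, by linarith⟩
  have hb' : 1 - a = b := by linarith
  rw [hb'] at h
  exact lt_of_le_of_lt h (max_lt hx hy)

theorem sublevel_interior17 {X : Type*} [NormedAddCommGroup X] [NormedSpace ℝ X]
    {f : X → ℝ} (hd : DenselyContinuous f) {m : ℝ} (hm : IsTopEssInf f m) {α : ℝ} (hα : m < α) :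
    (interior {x : X | f x < α}).Nonempty := by
  by_contra hcon
  refine hm.2 α hα ?_
  have hres : {x : X | ContinuousAt f x} ∈ residual X :=
    residual_of_dense_Gδ (IsGδ.setOfPred_continuousAt f) hd
  refine Filter.mem_of_superset hres fun x hx hxα => hcon ⟨x, ?_⟩
  rw [mem_interior_iff_mem_nhds]
  have hx' : ContinuousAt f x := hx
  exact hx'.eventually_lt continuousAt_const hxα

theorem cont_ge17 {X : Type*} [NormedAddCommGroup X] [NormedSpace ℝ X] [CompleteSpace X]
    {f : X → ℝ} {m : ℝ} (hm : IsTopEssInf f m) {x : X}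
    (hx : ContinuousAt f x) : m ≤ f x := by
  by_contra hlt
  push Not at hlt
  obtain ⟨α, h1, h2⟩ := exists_between hlt
  have hn : {y : X | f y < α} ∈ 𝓝 x := hx.eventually_lt continuousAt_const h1
  have hdense : Dense ({y : X | f y < α}ᶜ) := dense_of_mem_residual (hm.1 α h2)
  have : interior {y : X | f y < α} = ∅ := interior_eq_empty_iff_dense_compl.2 hdense
  have h3 := mem_interior_iff_mem_nhds.2 hn
  rw [this] at h3
  exact h3

theorem sublevel_closure17 {X : Type*} [NormedAddCommGroup X] [NormedSpace ℝ X] [CompleteSpace X]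
    {f : X → ℝ} (hd : DenselyContinuous f) {m : ℝ} (hm : IsTopEssInf f m) {α : ℝ} (hα : α < m) :
    interior (closure {x : X | f x < α}) = ∅ := by
  by_contra hne
  obtain ⟨x, hx1, hx2⟩ := hd.inter_open_nonempty _ isOpen_interior
    (Set.nonempty_iff_ne_empty.2 hne)
  have hx2' : ContinuousAt f x := hx2
  have h1 : α < f x := lt_of_lt_of_le hα (cont_ge17 hm hx2')
  have h2 : {y : X | α < f y} ∈ 𝓝 x := continuousAt_const.eventually_lt hx2' h1
  obtain ⟨y, hy1, hy2⟩ := mem_closure_iff_nhds.1 (interior_subset hx1) _ h2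
  exact lt_asymm (show α < f y from hy1) hy2

theorem ddag_midpoint17 {X : Type*} [NormedAddCommGroup X] [NormedSpace ℝ X]
    {F : Set X} (hF : Convex ℝ F) {y z : X} (hy : y ∈ Ddag F) (hz : z ∈ Ddag F) :
    (1/2:ℝ) • y + (1/2:ℝ) • z ∈ Ddag F := by
  simp only [Ddag, mem_iUnion] at hy hz ⊢
  obtain ⟨Y, hY, hy⟩ := hy
  obtain ⟨Z, hZ, hz⟩ := hz
  refine ⟨Y ⊔ Z, inferInstance, ?_⟩
  have hc : Convex ℝ (closure (F ∩ ((Y ⊔ Z : Submodule ℝ X) : Set X))) :=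
    (hF.inter (Submodule.convex _)).closure
  exact hc (closure_mono (inter_subset_inter_right _ (fun a ha => Submodule.mem_sup_left ha)) hy)
    (closure_mono (inter_subset_inter_right _ (fun a ha => Submodule.mem_sup_right ha)) hz)
    (by norm_num) (by norm_num) (by norm_num)

theorem good_point17 {X : Type*} [NormedAddCommGroup X] [NormedSpace ℝ X]
    {f : X → ℝ} {m : ℝ} {U : Set X} (hU : IsOpen U) (hle : ∀ x ∈ U, f x ≤ m)
    {x : X} (hx : x ∈ U) (h1 : x ∉ Ddag {x : X | f x < m})
    (h2 : ∀ k : ℕ, x ∉ closure {x : X | f x < m - 1 / ((k:ℝ) + 1)}) :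
    ContinuousAt f x ∧ ∃ L : X →L[ℝ] ℝ, GateauxDiffAt f x L := by
  have hD : ∀ Z : Submodule ℝ X, FiniteDimensional ℝ Z →
      x ∉ closure ({x : X | f x < m} ∩ (Z : Set X)) := by
    intro Z hZ hcl
    exact h1 (mem_iUnion.2 ⟨Z, mem_iUnion.2 ⟨hZ, hcl⟩⟩)
  have hfx : f x = m := by
    refine le_antisymm (hle x hx) ?_
    by_contra hlt
    push Not at hlt
    exact hD (Submodule.span ℝ {x}) inferInstance
      (subset_closure ⟨hlt, Submodule.mem_span_singleton_self x⟩)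
  constructor
  · rw [ContinuousAt, hfx, tendsto_order]
    constructor
    · intro a ha
      obtain ⟨k, hk⟩ := exists_nat_one_div_lt (sub_pos.2 ha)
      filter_upwards [isClosed_closure.isOpen_compl.mem_nhds (h2 k)] with y hy
      by_contra hya
      exact hy (subset_closure (show f y < m - 1 / ((k:ℝ)+1) by linarith))
    · intro b hb
      filter_upwards [hU.mem_nhds hx] with y hy
      exact lt_of_le_of_lt (hle y hy) hb
  · refine ⟨0, fun h => ?_⟩
    have hfd : FiniteDimensional ℝ (Submodule.span ℝ ({x, h} : Set X)) :=
      FiniteDimensional.span_of_finite ℝ (Set.toFinite _)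
    have hnot := hD _ hfd
    have hcont : ContinuousAt (fun t : ℝ => x + t • h) 0 := by fun_prop
    have e1 : ∀ᶠ t : ℝ in 𝓝 0, x + t • h ∈ U :=
      hcont (by simpa using hU.mem_nhds hx)
    have e2 : ∀ᶠ t : ℝ in 𝓝 0, x + t • h ∈
        (closure ({x : X | f x < m} ∩ (Submodule.span ℝ ({x, h} : Set X) : Set X)))ᶜ :=
      hcont (by simpa using isClosed_closure.isOpen_compl.mem_nhds hnot)
    refine tendsto_const_nhds.congr' ?_
    filter_upwards [e1.filter_mono nhdsWithin_le_nhds, e2.filter_mono nhdsWithin_le_nhds] with t ht1 ht2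
    have h3 : f (x + t • h) = m := by
      refine le_antisymm (hle _ ht1) ?_
      by_contra hlt
      push Not at hlt
      refine ht2 (subset_closure ⟨hlt, ?_⟩)
      exact Submodule.add_mem _ (Submodule.subset_span (by simp))
        (Submodule.smul_mem _ _ (Submodule.subset_span (by simp)))
    simp [h3, hfx]

theorem main17 {X : Type*} [NormedAddCommGroup X] [NormedSpace ℝ X] [CompleteSpace X]
    [SecondCountableTopology X] [MeasurableSpace X] [BorelSpace X]
    (f : X → ℝ) (hq : QuasiconvexFun f) (hd : DenselyContinuous f)
    (m : ℝ) (hm : IsTopEssInf f m)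
    (hint : interior (Ddag {x : X | f x < m}) = ∅) :
    Dense {x : X | ContinuousAt f x ∧ ∃ L : X →L[ℝ] ℝ, GateauxDiffAt f x L} ∧
    (IsReflexiveSpace X → HaarNull (Ddag {x : X | f x < m}) →
      HaarNull {x : X | ¬ (ContinuousAt f x ∧ ∃ L : X →L[ℝ] ℝ, GateauxDiffAt f x L)}) := by
  have hkpos : ∀ k : ℕ, (0:ℝ) < 1 / ((k:ℝ) + 1) := fun k => by positivity
  set Bad : Set X := {x : X | ¬ (ContinuousAt f x ∧ ∃ L : X →L[ℝ] ℝ, GateauxDiffAt f x L)}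
    with hBad
  let C : Set X := ⋂ k : ℕ, closure {x : X | f x < m + 1 / ((k:ℝ) + 1)}
  have hCcl : IsClosed C := isClosed_iInter fun k => isClosed_closure
  have hCcv : Convex ℝ C := convex_iInter fun k => (sublevel_convex17 hq _).closure
  let M : ℕ → Set X := fun k => closure {x : X | f x < m - 1 / ((k:ℝ) + 1)}
  have hMint : ∀ k, interior (M k) = ∅ := fun k =>
    sublevel_closure17 hd hm (by linarith [hkpos k])
  have hFint : ∀ k : ℕ, (interior {x : X | f x < m + 1 / ((k:ℝ) + 1)}).Nonempty := fun k =>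
    sublevel_interior17 hd hm (by linarith [hkpos k])
  have hle : ∀ x ∈ interior C, f x ≤ m := by
    intro x hx
    refine le_of_forall_pos_lt_add fun ε hε => ?_
    obtain ⟨k, hk⟩ := exists_nat_one_div_lt hε
    have h1 : x ∈ interior (closure {x : X | f x < m + 1 / ((k:ℝ) + 1)}) :=
      interior_mono (iInter_subset _ k) hx
    rw [(sublevel_convex17 hq _).interior_closure_eq_interior_of_nonempty_interior (hFint k)] at h1
    have h2 : x ∈ {x : X | f x < m + 1 / ((k:ℝ) + 1)} := interior_subset h1
    have h3 : f x < m + 1 / ((k:ℝ) + 1) := h2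
    linarith
  have hout : HaarNull (Bad ∩ Cᶜ) := by
    refine HaarNull.local17 fun x hx => ?_
    have hxC : x ∉ C := hx.2
    simp only [C, mem_iInter, not_forall] at hxC
    obtain ⟨k, hk⟩ := hxC
    obtain ⟨U, hUo, hxU, hU⟩ := quasi_local17 f hq _ (hFint k) x hk
    exact ⟨U, hUo, hxU, hU.mono17 fun y hy => ⟨hy.1.1, hy.2⟩⟩
  have hin : Bad ∩ interior C ⊆ Ddag {x : X | f x < m} ∪ ⋃ k, M k := by
    rintro x ⟨hxB, hxC⟩
    by_contra hcon
    simp only [mem_union, mem_iUnion, not_or, not_exists] at hcon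
    exact hxB (good_point17 isOpen_interior hle hxC hcon.1 hcon.2)
  constructor
  · rw [dense_iff_inter_open]
    intro U hUo hUne
    by_contra hcon
    have hUB : U ⊆ Bad := fun x hx hgood => hcon ⟨x, hx, hgood⟩
    by_cases hUC : U ⊆ C
    · have hUi : U ⊆ interior C := interior_maximal hUC hUo
      have hUE : U ⊆ Ddag {x : X | f x < m} := by
        intro x hx
        have hdense : Dense (⋂ k, ((M k)ᶜ ∩ (Homeomorph.subLeft ((2:ℝ) • x)) ⁻¹' (M k)ᶜ)) := by
          have hMd : ∀ k, Dense (M k)ᶜ := fun k => interior_eq_empty_iff_dense_compl.1 (hMint k)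
          have hMo : ∀ k, IsOpen (M k)ᶜ := fun k => isClosed_closure.isOpen_compl
          refine dense_iInter_of_isOpen (fun k => (hMo k).inter
            ((hMo k).preimage (Homeomorph.continuous _))) fun k => ?_
          exact (hMd k).inter_of_isOpen_left ((hMd k).preimage (Homeomorph.isOpenMap _)) (hMo k)
        have hVo : IsOpen (U ∩ (fun y => (2:ℝ) • x - y) ⁻¹' U) :=
          hUo.inter (hUo.preimage (by fun_prop))
        have h2x : (2:ℝ) • x - x = x := by module
        obtain ⟨y, hy1, hy2⟩ := hdense.inter_open_nonempty _ hVo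
          ⟨x, hx, show (2:ℝ) • x - x ∈ U by rw [h2x]; exact hx⟩
        rw [mem_iInter] at hy2
        have hE : ∀ z ∈ U, (∀ k, z ∉ M k) → z ∈ Ddag {x : X | f x < m} := by
          intro z hz hzM
          rcases hin ⟨hUB hz, hUi hz⟩ with h | h
          · exact h
          · obtain ⟨k, hk⟩ := mem_iUnion.1 h
            exact absurd hk (hzM k)
        have ha := hE y hy1.1 (fun k => (hy2 k).1)
        have hb := hE ((2:ℝ) • x - y) hy1.2 (fun k => (hy2 k).2)
        have := ddag_midpoint17 (sublevel_convex17 hq m) ha hb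
        convert this using 1
        module
      obtain ⟨x, hx⟩ := hUne
      have := interior_maximal hUE hUo hx
      rw [hint] at this
      exact this
    · obtain ⟨x, hx, hxC⟩ := not_subset.1 hUC
      exact hout.not_open17 (hUo.inter hCcl.isOpen_compl) ⟨x, hx, hxC⟩
        (fun y hy => ⟨hUB hy.1, hy.2⟩)
  · intro hR hDn
    have hMn : HaarNull (⋃ k, M k) := HaarNull.iUnion17 fun k =>
      matouskova17 hR isClosed_closure (sublevel_convex17 hq _).closure (hMint k)
    by_cases hCi : (interior C).Nonempty
    · refine (hout.union17 ((frontier_null17 C hCcv hCi).union17 (hDn.union17 hMn))).mono17 ?_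
      intro x hx
      by_cases h1 : x ∈ interior C
      · exact Or.inr (Or.inr (hin ⟨hx, h1⟩))
      · by_cases h2 : x ∈ C
        · exact Or.inr (Or.inl ⟨subset_closure h2, h1⟩)
        · exact Or.inl ⟨hx, h2⟩
    · refine (hout.union17 (matouskova17 hR hCcl hCcv (not_nonempty_iff_eq_empty.1 hCi))).mono17 ?_
      intro x hx
      by_cases h2 : x ∈ C
      · exact Or.inr h2
      · exact Or.inl ⟨hx, h2⟩

/-- If `(F_m)‡` has empty interior, `f` is continuous and Gâteaux differentiable on a
dense set; if moreover `X` is reflexive and `(F_m)‡` is contained in a Haar null set,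
the exceptional set is contained in a Haar null set. -/
theorem stmt_17 {X : Type*} [NormedAddCommGroup X] [NormedSpace ℝ X] [CompleteSpace X]
    [TopologicalSpace.SeparableSpace X] [MeasurableSpace X] [BorelSpace X]
    (f : X → ℝ) (hq : QuasiconvexFun f) (hd : DenselyContinuous f)
    (m : ℝ) (hm : IsTopEssInf f m)
    (hint : interior (Ddag {x : X | f x < m}) = ∅) :
    Dense {x : X | ContinuousAt f x ∧ ∃ L : X →L[ℝ] ℝ, GateauxDiffAt f x L} ∧
    (IsReflexiveSpace X → HaarNull (Ddag {x : X | f x < m}) →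
      HaarNull {x : X | ¬ (ContinuousAt f x ∧ ∃ L : X →L[ℝ] ℝ, GateauxDiffAt f x L)}) := by
  haveI : SecondCountableTopology X := UniformSpace.secondCountable_of_separable X
  exact main17 f hq hd m hm hint
end

section
/- Let X be a separable real Banach space and let f : X → ℝ be even (f(−x) = f(x) for all x ∈ X), quasiconvex and densely continuous. Then the set of points at which f is both continuous and Gâteaux differentiable is dense in X. If moreover X is reflexive, then the set of points at which f fails to be continuous or fails to be Gâteaux differentiable is contained in a Haar null set. -/
open Filter Topology Set MeasureTheory

/-- sets covered by countably many Borel sets, each null on all lines of some direction -/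
def LineNull {X : Type*} [NormedAddCommGroup X] [NormedSpace ℝ X]
    [MeasurableSpace X] (E : Set X) : Prop :=
  ∃ (B : ℕ → Set X) (ξ : ℕ → X), E ⊆ ⋃ n, B n ∧ ∀ n, MeasurableSet (B n) ∧
    ∀ x : X, MeasureTheory.volume {t : ℝ | x + t • ξ n ∈ B n} = 0

section LN
variable {X : Type*} [NormedAddCommGroup X] [NormedSpace ℝ X] [MeasurableSpace X]

lemma LineNull.mono {E F : Set X} (h : LineNull F) (hEF : E ⊆ F) : LineNull E := by
  obtain ⟨B, ξ, h1, h2⟩ := h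
  exact ⟨B, ξ, hEF.trans h1, h2⟩

lemma LineNull.iUnion {ι : Type*} [Countable ι] {E : ι → Set X} (h : ∀ i, LineNull (E i)) :
    LineNull (⋃ i, E i) := by
  rcases isEmpty_or_nonempty ι with hι | hι
  · refine ⟨fun _ => ∅, fun _ => 0, by simp, by simp⟩
  choose B ξ h1 h2 using h
  obtain ⟨e, he⟩ := exists_surjective_nat (ι × ℕ)
  refine ⟨fun n => B (e n).1 (e n).2, fun n => ξ (e n).1 (e n).2, ?_, fun n => h2 _ _⟩
  intro x hx
  obtain ⟨i, hi⟩ := mem_iUnion.1 hx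
  obtain ⟨k, hk⟩ := mem_iUnion.1 (h1 i hi)
  obtain ⟨n, hn⟩ := he (i, k)
  refine mem_iUnion.2 ⟨n, ?_⟩
  simpa [hn] using hk

lemma LineNull.union {E F : Set X} (h : LineNull E) (h' : LineNull F) : LineNull (E ∪ F) := by
  rw [union_eq_iUnion]
  exact LineNull.iUnion (by rintro (_ | _) <;> assumption)

lemma LineNull.single {B : Set X} (hB : MeasurableSet B) (v : X)
    (h : ∀ x : X, MeasureTheory.volume {t : ℝ | x + t • v ∈ B} = 0) : LineNull B :=
  ⟨fun _ => B, fun _ => v, subset_iUnion (fun _ : ℕ => B) 0, fun _ => ⟨hB, h⟩⟩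

lemma map_update_infinitePi (n : ℕ) :
    ((Measure.infinitePi (fun _ : ℕ => (volume : Measure unitInterval))).prod volume).map
      (fun p : (ℕ → unitInterval) × unitInterval => Function.update p.1 n p.2)
      = Measure.infinitePi (fun _ : ℕ => (volume : Measure unitInterval)) := by
  have hm : Measurable (fun p : (ℕ → unitInterval) × unitInterval =>
      Function.update p.1 n p.2) := by
    rw [measurable_pi_iff]
    intro i
    by_cases hi : i = n
    · subst hi
      simpa using measurable_snd
    · simp only [Function.update_of_ne hi]
      fun_prop
  apply Measure.eq_infinitePi
  intro s t ht
  rw [Measure.map_apply hm (MeasurableSet.pi s.countable_toSet (fun i _ => ht i))]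
  have : (fun p : (ℕ → unitInterval) × unitInterval => Function.update p.1 n p.2) ⁻¹'
      (Set.pi s t) = (Set.pi (s.erase n) t) ×ˢ (if n ∈ s then t n else univ) := by
    ext ⟨p, q⟩
    simp only [mem_preimage, Set.mem_pi, mem_prod, Finset.coe_erase]
    constructor
    · intro h
      refine ⟨fun i hi => ?_, ?_⟩
      · have := h i hi.1
        rwa [Function.update_of_ne (by simpa using hi.2)] at this
      · split_ifs with hn
        · simpa using h n hn
        · trivial
    · rintro ⟨h1, h2⟩ i hi
      by_cases hin : i = n
      · subst hin
        have : i ∈ s := hi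
        simpa [this] using h2
      · rw [Function.update_of_ne hin]
        exact h1 i ⟨hi, by simpa using hin⟩
  rw [this, Measure.prod_prod, Measure.infinitePi_pi _ (fun i _ => ht i)]
  split_ifs with hn
  · rw [Finset.prod_erase_mul _ _ hn]
  · rw [measure_univ, mul_one, Finset.erase_eq_of_notMem hn]

lemma LineNull.haarNull [CompleteSpace X] [TopologicalSpace.SeparableSpace X] [BorelSpace X]
    {E : Set X} (h : LineNull E) : HaarNull E := by
  obtain ⟨B, ξ, h1, h2⟩ := h
  have : SecondCountableTopology X := UniformSpace.secondCountable_of_separable X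
  set c : ℕ → ℝ := fun n => (1/2)^n / (1 + ‖ξ n‖) with hc
  have hcpos : ∀ n, 0 < c n := fun n => by positivity
  set Φ : (ℕ → unitInterval) → X := fun t => ∑' n, ((t n : ℝ) * c n) • ξ n with hΦ
  have hbd : ∀ n (s : unitInterval), ‖((s : ℝ) * c n) • ξ n‖ ≤ (1/2 : ℝ)^n := by
    intro n s
    rw [norm_smul, norm_mul, Real.norm_of_nonneg s.2.1, Real.norm_of_nonneg (hcpos n).le]
    have h1 : c n * ‖ξ n‖ ≤ (1/2)^n := by
      rw [hc]
      simp only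
      rw [div_mul_eq_mul_div, div_le_iff₀ (by positivity)]
      have : (0:ℝ) < (1/2)^n := by positivity
      nlinarith [norm_nonneg (ξ n)]
    have h2 : 0 ≤ c n * ‖ξ n‖ := mul_nonneg (hcpos n).le (norm_nonneg _)
    calc (s : ℝ) * c n * ‖ξ n‖ = s * (c n * ‖ξ n‖) := by ring
      _ ≤ 1 * (c n * ‖ξ n‖) := by gcongr; exact s.2.2
      _ ≤ _ := by linarith
  have hsum : Summable (fun n : ℕ => (1/2 : ℝ)^n) := summable_geometric_two
  have hΦc : Continuous Φ := by
    apply continuous_tsum (u := fun n : ℕ => (1/2 : ℝ)^n) _ hsum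
    · intro n t
      exact hbd n (t n)
    · intro n
      fun_prop
  have hupd : ∀ t n (s : unitInterval), Φ (Function.update t n s) =
      Φ (Function.update t n 0) + ((s : ℝ) * c n) • ξ n := by
    intro t n s
    have hs : ∀ t : ℕ → unitInterval, Summable (fun k => ((t k : ℝ) * c k) • ξ k) :=
      fun t => Summable.of_norm_bounded hsum (fun k => hbd k (t k))
    rw [hΦ]
    simp only
    rw [← sub_eq_iff_eq_add', ← (hs _).tsum_sub (hs _)]
    rw [tsum_eq_single n]
    · simp
    · intro k hk
      simp [Function.update_of_ne hk]
  set ν := Measure.infinitePi (fun _ : ℕ => (volume : Measure unitInterval)) with hν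
  refine ⟨⋃ n, B n, h1, MeasurableSet.iUnion (fun n => (h2 n).1), ν.map Φ,
    Measure.isProbabilityMeasure_map hΦc.measurable.aemeasurable, ?_⟩
  intro x
  rw [image_iUnion]
  refine measure_iUnion_null fun n => ?_
  have himg : (fun y => x + y) '' B n = (fun y => -x + y) ⁻¹' (B n) := by
    ext y
    simp
  have hmeas : MeasurableSet ((fun y => -x + y) ⁻¹' (B n)) :=
    ((continuous_const.add continuous_id).measurable) (h2 n).1
  have hmu : Measurable (fun p : (ℕ → unitInterval) × unitInterval =>
      Function.update p.1 n p.2) := by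
    rw [measurable_pi_iff]
    intro i
    by_cases hi : i = n
    · subst hi
      simpa using measurable_snd
    · simp only [Function.update_of_ne hi]
      fun_prop
  rw [himg, Measure.map_apply hΦc.measurable hmeas, hν, ← map_update_infinitePi n,
    Measure.map_apply hmu (hΦc.measurable hmeas), Measure.measure_prod_null
      (hmu (hΦc.measurable hmeas))]
  refine Filter.Eventually.of_forall fun t => ?_
  simp only [Pi.zero_apply]
  have hz := (h2 n).2 (-x + Φ (Function.update t n 0))
  have hz2 : volume ((fun s : ℝ => s * c n) ⁻¹'
      {t_1 : ℝ | -x + Φ (Function.update t n 0) + t_1 • ξ n ∈ B n}) = 0 := by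
    rw [Real.volume_preimage_mul_right (hcpos n).ne', hz, mul_zero]
  have : (Prod.mk t ⁻¹' ((fun p : (ℕ → unitInterval) × unitInterval =>
      Function.update p.1 n p.2) ⁻¹' (Φ ⁻¹' ((fun y => -x + y) ⁻¹' B n)))) =
      (Subtype.val : unitInterval → ℝ) ⁻¹' ((fun s : ℝ => s * c n) ⁻¹'
      {t_1 : ℝ | -x + Φ (Function.update t n 0) + t_1 • ξ n ∈ B n}) := by
    ext s
    simp only [mem_preimage, mem_ofPred_eq, hupd t n s, add_assoc]
  rw [this]
  refine le_antisymm ?_ bot_le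
  have hmp : MeasurableEmbedding (Subtype.val : unitInterval → ℝ) :=
    MeasurableEmbedding.subtype_coe measurableSet_Icc
  calc volume ((Subtype.val : unitInterval → ℝ) ⁻¹' ((fun s : ℝ => s * c n) ⁻¹'
      {t_1 : ℝ | -x + Φ (Function.update t n 0) + t_1 • ξ n ∈ B n}))
      = Measure.comap Subtype.val volume ((Subtype.val : unitInterval → ℝ) ⁻¹'
        ((fun s : ℝ => s * c n) ⁻¹'
      {t_1 : ℝ | -x + Φ (Function.update t n 0) + t_1 • ξ n ∈ B n})) := rfl
    _ = volume (Subtype.val '' ((Subtype.val : unitInterval → ℝ) ⁻¹'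
        ((fun s : ℝ => s * c n) ⁻¹'
      {t_1 : ℝ | -x + Φ (Function.update t n 0) + t_1 • ξ n ∈ B n}))) := by
        rw [hmp.comap_apply]
    _ ≤ volume ((fun s : ℝ => s * c n) ⁻¹'
      {t_1 : ℝ | -x + Φ (Function.update t n 0) + t_1 • ξ n ∈ B n}) :=
        measure_mono (image_preimage_subset _ _)
    _ = 0 := hz2

lemma HaarNull.dense_compl [TopologicalSpace.SeparableSpace X] [BorelSpace X]
    {E : Set X} (h : HaarNull E) : Dense Eᶜ := by
  obtain ⟨B, hEB, hB, μ, hμ, h0⟩ := h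
  rw [← interior_eq_empty_iff_dense_compl]
  by_contra hne
  obtain ⟨z, hz⟩ := nonempty_iff_ne_empty.2 hne
  obtain ⟨ε, hε, hball⟩ := Metric.isOpen_iff.1 isOpen_interior z hz
  have hball' : Metric.ball z ε ⊆ B := hball.trans (interior_subset.trans hEB)
  obtain ⟨D, hDc, hD⟩ := TopologicalSpace.exists_countable_dense X
  have hcov : (univ : Set X) ⊆ ⋃ d ∈ D, (fun y => d + y) '' B := by
    intro y _
    obtain ⟨d, hdD, hd⟩ := Metric.dense_iff.1 hD (y - z) ε hε
    simp only [mem_iUnion]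
    refine ⟨d, hd, y - d, hball' ?_, by simp⟩
    rw [mem_ball_iff_norm] at hdD ⊢
    have e : y - d - z = -(d - (y - z)) := by abel
    rw [e, norm_neg]
    exact hdD
  have : μ univ = 0 := by
    refine measure_mono_null hcov ?_
    rw [measure_biUnion_null_iff hDc]
    exact fun d _ => h0 d
  simp at this

lemma LineNull.span [CompleteSpace X] [BorelSpace X] {C : Set X} (hC : IsClosed C)
    (hconv : Convex ℝ C) (hsymm : ∀ x ∈ C, -x ∈ C) (hInterior : interior C = ∅)
    (hCne : C.Nonempty) :
    LineNull (Submodule.span ℝ C : Set X) := by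
  obtain ⟨c0, hc0⟩ := hCne
  have hbal : ∀ x ∈ C, ∀ t : ℝ, |t| ≤ 1 → t • x ∈ C := by
    intro x hx t ht
    rw [abs_le] at ht
    have := hconv hx (hsymm x hx) (a := (1+t)/2) (b := (1-t)/2) (by linarith) (by linarith)
      (by ring)
    convert this using 1
    module
  have hspan : ∀ x ∈ Submodule.span ℝ C, ∃ n : ℕ, ((n : ℝ) + 1)⁻¹ • x ∈ C := by
    intro x hx
    have key : ∃ a : ℝ, 0 < a ∧ a • x ∈ C := by
      induction hx using Submodule.span_induction with
      | mem x h => exact ⟨1, one_pos, by simpa⟩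
      | zero => exact ⟨1, one_pos, by simpa using hbal c0 hc0 0 (by simp)⟩
      | add x y _ _ hx hy =>
        obtain ⟨a, ha, hax⟩ := hx
        obtain ⟨b, hb, hby⟩ := hy
        refine ⟨min a b / 2, by positivity, ?_⟩
        have h1 := hbal _ hax (min a b / a) (by
          rw [abs_of_nonneg (by positivity), div_le_one ha]; exact min_le_left _ _)
        have h2 := hbal _ hby (min a b / b) (by
          rw [abs_of_nonneg (by positivity), div_le_one hb]; exact min_le_right _ _)
        have := hconv h1 h2 (a := 1/2) (b := 1/2) (by norm_num) (by norm_num) (by norm_num)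
        rw [smul_smul _ a, smul_smul _ b, div_mul_cancel₀ _ ha.ne', div_mul_cancel₀ _ hb.ne'] at this
        convert this using 1
        module
      | smul c x _ hx =>
        obtain ⟨a, ha, hax⟩ := hx
        refine ⟨a / (1 + |c|), by positivity, ?_⟩
        have := hbal _ hax (c / (1 + |c|)) (by
          rw [abs_div, abs_of_nonneg (by positivity : 0 ≤ 1 + |c|), div_le_one (by positivity)]
          linarith)
        convert this using 1
        rw [smul_smul, smul_smul]
        congr 1
        ring
    obtain ⟨a, ha, hax⟩ := key
    obtain ⟨n, hn⟩ := exists_nat_gt (1 / a)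
    refine ⟨n, ?_⟩
    have := hbal _ hax (((n : ℝ) + 1)⁻¹ / a) (by
      rw [abs_of_nonneg (by positivity), div_le_one ha, inv_le_comm₀ (by positivity) ha]
      rw [one_div] at hn
      linarith)
    rwa [smul_smul, div_mul_cancel₀ _ ha.ne'] at this
  have hEq : (Submodule.span ℝ C : Set X) = ⋃ n : ℕ, {x : X | ((n : ℝ) + 1)⁻¹ • x ∈ C} := by
    ext x
    simp only [SetLike.mem_coe, mem_iUnion, mem_ofPred_eq]
    refine ⟨hspan x, ?_⟩
    rintro ⟨n, hn⟩
    have hn' : ((n : ℝ) + 1)⁻¹ ≠ 0 := by positivity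
    exact ((Submodule.span ℝ C).smul_mem_iff hn').1 (Submodule.subset_span hn)
  have hcl : ∀ n : ℕ, IsClosed {x : X | ((n : ℝ) + 1)⁻¹ • x ∈ C} := fun n =>
    hC.preimage (continuous_const_smul _)
  have hne : (Submodule.span ℝ C : Set X) ≠ univ := by
    intro hu
    rw [hEq] at hu
    obtain ⟨n, z, hz⟩ := nonempty_interior_of_iUnion_of_closed hcl hu
    have hn' : ((n : ℝ) + 1)⁻¹ ≠ 0 := by positivity
    have hop : IsOpen ((fun x : X => ((n : ℝ) + 1)⁻¹ • x) ''
        interior {x : X | ((n : ℝ) + 1)⁻¹ • x ∈ C}) :=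
      (isOpenMap_smul₀ hn') _ isOpen_interior
    have hsub : ((fun x : X => ((n : ℝ) + 1)⁻¹ • x) ''
        interior {x : X | ((n : ℝ) + 1)⁻¹ • x ∈ C}) ⊆ C := by
      rintro _ ⟨y, hy, rfl⟩
      exact interior_subset (s := {x : X | ((n : ℝ) + 1)⁻¹ • x ∈ C}) hy
    have := interior_maximal hsub hop ⟨z, hz, rfl⟩
    rw [hInterior] at this
    exact this
  obtain ⟨v, hv⟩ := (ne_univ_iff_exists_notMem _).1 hne
  refine LineNull.single ?_ v ?_
  · rw [hEq]
    exact MeasurableSet.iUnion fun n => (hcl n).measurableSet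
  · intro x
    refine Set.Subsingleton.measure_zero ?_ _
    intro s hs t ht
    by_contra hst
    apply hv
    have h1 : (s - t) • v ∈ Submodule.span ℝ C := by
      have := (Submodule.span ℝ C).sub_mem hs ht
      convert this using 1
      module
    exact ((Submodule.span ℝ C).smul_mem_iff (sub_ne_zero.2 hst)).1 h1

lemma LineNull.exists_span [CompleteSpace X] [BorelSpace X] {C : Set X}
    (hconv : Convex ℝ C) (hsymm : ∀ x ∈ C, -x ∈ C) (hInterior : interior (closure C) = ∅) :
    ∃ E : Set X, LineNull E ∧ closure C ⊆ E ∧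
      ∀ y ∈ C, ∀ z ∈ C, ∀ a b : ℝ, a • y + b • z ∈ E := by
  rcases C.eq_empty_or_nonempty with rfl | hne
  · exact ⟨∅, ⟨fun _ => ∅, fun _ => 0, by simp, by simp⟩, by simp, by simp⟩
  · refine ⟨Submodule.span ℝ (closure C), LineNull.span isClosed_closure hconv.closure ?_ hInterior
      hne.closure, Submodule.subset_span, ?_⟩
    · intro x hx
      exact map_mem_closure continuous_neg hx hsymm
    · intro y hy z hz a b
      exact Submodule.add_mem _
        (Submodule.smul_mem _ _ (Submodule.subset_span (subset_closure hy)))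
        (Submodule.smul_mem _ _ (Submodule.subset_span (subset_closure hz)))

end LN

/-- an odd, rationally homogeneous quasiconvex function is additive -/
lemma additive_of_quasiconvex_odd {V : Type*} [AddCommGroup V] [Module ℝ V] (D : Set V)
    (hadd : ∀ v ∈ D, ∀ w ∈ D, v + w ∈ D) (hsm : ∀ (a : ℚ), ∀ v ∈ D, (a : ℝ) • v ∈ D)
    (q : V → ℝ) (hh : ∀ (a : ℚ), ∀ v ∈ D, q ((a : ℝ) • v) = a * q v)
    (hqc : ∀ v ∈ D, ∀ w ∈ D, ∀ a : ℚ, 0 ≤ a → a ≤ 1 →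
      q ((a : ℝ) • v + ((1 - a : ℚ) : ℝ) • w) ≤ max (q v) (q w)) :
    ∀ v ∈ D, ∀ w ∈ D, q (v + w) = q v + q w := by
  have hnegm : ∀ v ∈ D, -v ∈ D := fun v hv => by simpa using hsm (-1) v hv
  have hneg : ∀ v ∈ D, q (-v) = - q v := fun v hv => by simpa using hh (-1) v hv
  have hcomb : ∀ v ∈ D, ∀ w ∈ D, ∀ a b : ℚ, 0 < a → 0 < b →
      q (v + w) ≤ (a + b) * max (q v / a) (q w / b) := by
    intro v hv w hw a b ha hb
    have haR : (0:ℝ) < a := by exact_mod_cast ha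
    have hbR : (0:ℝ) < b := by exact_mod_cast hb
    have h1 := hqc _ (hsm a⁻¹ v hv) _ (hsm b⁻¹ w hw) (a / (a + b)) (by positivity)
      (by rw [div_le_one (by positivity)]; linarith)
    have e : (((a / (a + b) : ℚ)) : ℝ) • (((a⁻¹ : ℚ) : ℝ) • v) +
        ((1 - a / (a + b) : ℚ) : ℝ) • (((b⁻¹ : ℚ) : ℝ) • w) =
        (((a + b)⁻¹ : ℚ) : ℝ) • (v + w) := by
      rw [smul_smul, smul_smul, smul_add]
      congr 2
      · push_cast; field_simp
      · push_cast; field_simp; ring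
    rw [e, hh _ _ (hadd v hv w hw), hh _ _ hv, hh _ _ hw] at h1
    push_cast at h1
    rw [inv_mul_le_iff₀ (by positivity)] at h1
    simpa [div_eq_inv_mul] using h1
  have hS1 : ∀ v ∈ D, ∀ w ∈ D, 0 ≤ q v → 0 ≤ q w → q (v + w) ≤ q v + q w := by
    intro v hv w hw h1 h2
    apply le_of_forall_pos_le_add
    intro ε hε
    obtain ⟨a, ha1, ha2⟩ := exists_rat_btwn (show q v < q v + ε / 2 by linarith)
    obtain ⟨b, hb1, hb2⟩ := exists_rat_btwn (show q w < q w + ε / 2 by linarith)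
    have haR : (0:ℝ) < a := by linarith
    have hbR : (0:ℝ) < b := by linarith
    have := hcomb v hv w hw a b (by exact_mod_cast haR) (by exact_mod_cast hbR)
    have hm : max (q v / a) (q w / b) ≤ 1 :=
      max_le ((div_le_one haR).2 ha1.le) ((div_le_one hbR).2 hb1.le)
    nlinarith
  have hS2 : ∀ v ∈ D, ∀ w ∈ D, 0 < q v → 0 < q w → q v + q w ≤ q (v + w) := by
    intro v hv w hw h1 h2
    apply le_of_forall_pos_le_add
    intro ε hε
    obtain ⟨a, ha1, ha2⟩ := exists_rat_btwn (show max 0 (q v - ε / 2) < q v by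
      apply max_lt <;> linarith)
    obtain ⟨b, hb1, hb2⟩ := exists_rat_btwn (show max 0 (q w - ε / 2) < q w by
      apply max_lt <;> linarith)
    rw [max_lt_iff] at ha1 hb1
    have haR : (0:ℝ) < a := ha1.1
    have hbR : (0:ℝ) < b := hb1.1
    have := hcomb _ (hnegm v hv) _ (hnegm w hw) a b (by exact_mod_cast haR)
      (by exact_mod_cast hbR)
    rw [← neg_add, hneg _ (hadd v hv w hw), hneg v hv, hneg w hw] at this
    have hm : max (-q v / a) (-q w / b) ≤ -1 := by
      apply max_le
      · rw [div_le_iff₀ haR]; linarith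
      · rw [div_le_iff₀ hbR]; linarith
    nlinarith
  have hS3 : ∀ v ∈ D, ∀ w ∈ D, 0 ≤ q v → q w = 0 → q v ≤ q (v + w) := by
    intro v hv w hw h1 h2
    have hvw := hadd v hv w hw
    rcases le_or_gt 0 (q (v + w)) with h3 | h3
    · have := hS1 _ hvw _ (hnegm w hw) h3 (by rw [hneg w hw, h2]; simp)
      rw [add_neg_cancel_right, hneg w hw, h2] at this
      linarith
    · exfalso
      have hn : 0 < q (-(v + w)) := by rw [hneg _ hvw]; linarith
      rcases h1.lt_or_eq with h4 | h4
      · have := hS2 v hv _ (hnegm _ hvw) h4 hn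
        have e : v + -(v + w) = -w := by abel
        rw [e, hneg w hw] at this
        linarith
      · have := hS1 _ (hnegm v hv) _ (hnegm w hw) (by rw [hneg v hv]; linarith)
          (by rw [hneg w hw]; linarith)
        rw [← neg_add, hneg v hv, hneg w hw] at this
        linarith
  have hpos : ∀ v ∈ D, ∀ w ∈ D, 0 ≤ q v → 0 ≤ q w → q (v + w) = q v + q w := by
    intro v hv w hw h1 h2
    refine le_antisymm (hS1 v hv w hw h1 h2) ?_
    rcases h1.lt_or_eq with h3 | h3
    · rcases h2.lt_or_eq with h4 | h4
      · exact hS2 v hv w hw h3 h4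
      · have := hS3 v hv w hw h1 h4.symm
        linarith
    · have := hS3 w hw v hv h2 h3.symm
      rw [add_comm] at this
      linarith
  have hnp : ∀ v ∈ D, ∀ w ∈ D, q v ≤ 0 → q w ≤ 0 → q (v + w) = q v + q w := by
    intro v hv w hw h1 h2
    have := hpos _ (hnegm v hv) _ (hnegm w hw) (by rw [hneg v hv]; linarith)
      (by rw [hneg w hw]; linarith)
    rw [← neg_add, hneg _ (hadd v hv w hw), hneg v hv, hneg w hw] at this
    linarith
  have hmix : ∀ v ∈ D, ∀ w ∈ D, 0 ≤ q v → q w ≤ 0 → q (v + w) = q v + q w := by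
    intro v hv w hw h1 h2
    have hvw := hadd v hv w hw
    rcases le_total 0 (q (v + w)) with h3 | h3
    · have := hpos _ hvw _ (hnegm w hw) h3 (by rw [hneg w hw]; linarith)
      rw [add_neg_cancel_right, hneg w hw] at this
      linarith
    · have := hnp _ hvw _ (hnegm v hv) h3 (by rw [hneg v hv]; linarith)
      have e : v + w + -v = w := by abel
      rw [e, hneg v hv] at this
      linarith
  intro v hv w hw
  rcases le_total 0 (q v) with h1 | h1 <;> rcases le_total 0 (q w) with h2 | h2
  · exact hpos v hv w hw h1 h2
  · exact hmix v hv w hw h1 h2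
  · rw [add_comm v w, hmix w hw v hv h2 h1, add_comm]
  · exact hnp v hv w hw h1 h2

/-- a quasiconvex function of one real variable is differentiable almost everywhere -/
lemma quasiconvex_real_ae_diff (φ : ℝ → ℝ) (hφ : QuasiconvexFun φ) :
    ∀ᵐ t : ℝ, DifferentiableAt ℝ φ t := by
  have hq : ∀ a b c : ℝ, a ≤ b → b ≤ c → φ b ≤ max (φ a) (φ c) := by
    intro a b c hab hbc
    rcases (hab.trans hbc).eq_or_lt with h | h
    · have : b = a := by linarith
      rw [this]; exact le_max_left _ _
    · have h' : 0 < c - a := by linarith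
      have := hφ a c ((c - b) / (c - a)) ⟨div_nonneg (by linarith) h'.le,
        (div_le_one h').2 (by linarith)⟩
      convert this using 2
      simp only [smul_eq_mul]
      field_simp
      ring
  have hkey : ∀ s : Set ℝ, s.OrdConnected → (MonotoneOn φ s ∨ AntitoneOn φ s) →
      ∀ᵐ t : ℝ, t ∈ s → DifferentiableAt ℝ φ t := by
    intro s hs hmono
    have h1 : ∀ᵐ t : ℝ, t ∈ s → DifferentiableWithinAt ℝ φ s t := by
      rcases hmono with h | h
      · exact h.ae_differentiableWithinAt_of_mem
      · filter_upwards [h.neg.ae_differentiableWithinAt_of_mem] with t ht hts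
        simpa using (ht hts).neg
    have h2 : ∀ᵐ t : ℝ, t ∉ frontier s := by
      rw [ae_iff]
      simpa using hs.convex.addHaar_frontier (μ := volume)
    filter_upwards [h1, h2] with t ht1 ht2 hts
    refine (ht1 hts).differentiableAt ?_
    have : t ∈ interior s := by
      by_contra h
      exact ht2 ⟨subset_closure hts, h⟩
    exact mem_interior_iff_mem_nhds.1 this
  have hU : ∀ᵐ t : ℝ, t ∈ {t | ∃ a < t, φ a < φ t} → DifferentiableAt ℝ φ t := by
    have hm : ∀ t a, a < t → φ a < φ t → ∀ s, t ≤ s → φ t ≤ φ s := by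
      intro t a hat h s hts
      rcases le_max_iff.1 (hq a t s hat.le hts) with h' | h'
      · linarith
      · exact h'
    refine hkey _ ⟨?_⟩ (Or.inl ?_)
    · rintro t ⟨a, hat, ha⟩ t' _ s ⟨hs, _⟩
      exact ⟨a, by linarith, ha.trans_le (hm t a hat ha s hs)⟩
    · rintro t ⟨a, hat, ha⟩ t' _ htt'
      exact hm t a hat ha t' htt'
  have hV : ∀ᵐ t : ℝ, t ∈ {t | ∃ a > t, φ a < φ t} → DifferentiableAt ℝ φ t := by
    have hm : ∀ t a, t < a → φ a < φ t → ∀ s, s ≤ t → φ t ≤ φ s := by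
      intro t a hat h s hts
      rcases le_max_iff.1 (hq s t a hts hat.le) with h' | h'
      · exact h'
      · linarith
    refine hkey _ ⟨?_⟩ (Or.inr ?_)
    · rintro t' _ t ⟨a, hat, ha⟩ s ⟨_, hs⟩
      exact ⟨a, by linarith, ha.trans_le (hm t a hat ha s hs)⟩
    · rintro t' _ t ⟨a, hat, ha⟩ htt'
      exact hm t a hat ha t' htt'
  have hZ : ∀ᵐ t : ℝ, t ∈ {t | ∀ a, φ t ≤ φ a} → DifferentiableAt ℝ φ t := by
    refine hkey _ ⟨?_⟩ (Or.inl ?_)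
    · rintro t ht t' ht' s ⟨hs, hs'⟩ a
      exact (hq t s t' hs hs').trans (max_le (ht a) (ht' a))
    · rintro t ht t' ht' _
      exact ht t'
  filter_upwards [hU, hV, hZ] with t h1 h2 h3
  by_cases hz : ∀ a, φ t ≤ φ a
  · exact h3 hz
  · push Not at hz
    obtain ⟨a, ha⟩ := hz
    rcases lt_trichotomy a t with h | h | h
    · exact h1 ⟨a, h, ha⟩
    · rw [h] at ha; exact absurd ha (lt_irrefl _)
    · exact h2 ⟨a, h, ha⟩

/-- upper envelope of `f` -/
noncomputable def upperEnv {X : Type*} [TopologicalSpace X] (f : X → ℝ) (x : X) : ℝ :=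
  sInf {q : ℝ | x ∈ interior {y | f y < q}}

lemma QuasiconvexFun.convex_lt {X : Type*} [AddCommGroup X] [Module ℝ X] {f : X → ℝ}
    (hf : QuasiconvexFun f) (q : ℝ) : Convex ℝ {y | f y < q} := by
  intro x hx y hy a b ha hb hab
  have := hf x y a ⟨ha, by linarith⟩
  have e : 1 - a = b := by linarith
  rw [e] at this
  exact this.trans_lt (max_lt hx hy)

section Env
variable {X : Type*} [NormedAddCommGroup X] [NormedSpace ℝ X]
  {f : X → ℝ} {β r : ℝ}

lemma env_interior (hf : QuasiconvexFun f) (hβ : ∀ x, β ≤ f x)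
    (hball : ∀ b : X, ‖b‖ < r → f b ≤ β) {y z : X} {s q : ℝ} (hs : 0 < s) (hs1 : s ≤ 1)
    (hb : ‖y + s⁻¹ • (z - y)‖ < r) (hq : f y < q) : z ∈ interior {y | f y < q} := by
  have hbi : y + s⁻¹ • (z - y) ∈ interior {y | f y < q} := by
    have hsub : Metric.ball (0:X) r ⊆ {y | f y < q} := by
      intro b hb
      exact (hball b (by simpa using hb)).trans_lt ((hβ y).trans_lt hq)
    exact interior_maximal hsub Metric.isOpen_ball (by simpa using hb)
  have := (hf.convex_lt q).combo_interior_self_mem_interior hbi (show y ∈ {y | f y < q} from hq)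
    hs (show 0 ≤ 1 - s by linarith) (by ring)
  convert this using 1
  rw [smul_add, smul_smul, mul_inv_cancel₀ hs.ne']
  module

lemma env_bdd (hβ : ∀ x, β ≤ f x) (x : X) : BddBelow {q : ℝ | x ∈ interior {y | f y < q}} :=
  ⟨β, fun _ hq => (hβ x).trans (interior_subset hq).le⟩

lemma env_nonempty (hf : QuasiconvexFun f) (hβ : ∀ x, β ≤ f x) (hr : 0 < r)
    (hball : ∀ b : X, ‖b‖ < r → f b ≤ β) (x : X) :
    {q : ℝ | x ∈ interior {y | f y < q}}.Nonempty := by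
  refine ⟨f ((2:ℝ) • x) + 1, env_interior hf hβ hball (y := (2:ℝ) • x) (s := 1/2)
    (by norm_num) (by norm_num) ?_ (by linarith)⟩
  have : (2:ℝ) • x + (1/2:ℝ)⁻¹ • (x - (2:ℝ) • x) = 0 := by
    norm_num
    module
  rw [this]
  simpa using hr

lemma env_lt_iff (hf : QuasiconvexFun f) (hβ : ∀ x, β ≤ f x) (hr : 0 < r)
    (hball : ∀ b : X, ‖b‖ < r → f b ≤ β) (x : X) (q : ℝ) :
    upperEnv f x < q ↔ ∃ p < q, x ∈ interior {y | f y < p} := by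
  rw [upperEnv, csInf_lt_iff (env_bdd hβ x) (env_nonempty hf hβ hr hball x)]
  simp only [mem_ofPred_eq]
  exact ⟨fun ⟨a, h1, h2⟩ => ⟨a, h2, h1⟩, fun ⟨a, h1, h2⟩ => ⟨a, h2, h1⟩⟩

lemma le_env (hf : QuasiconvexFun f) (hβ : ∀ x, β ≤ f x) (hr : 0 < r)
    (hball : ∀ b : X, ‖b‖ < r → f b ≤ β) (x : X) : f x ≤ upperEnv f x :=
  le_csInf (env_nonempty hf hβ hr hball x) fun _ hq => (interior_subset hq).le

lemma env_le (hf : QuasiconvexFun f) (hβ : ∀ x, β ≤ f x)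
    (hball : ∀ b : X, ‖b‖ < r → f b ≤ β) {y z : X} {s : ℝ} (hs : 0 < s) (hs1 : s ≤ 1)
    (hb : ‖y + s⁻¹ • (z - y)‖ < r) : upperEnv f z ≤ f y := by
  apply le_of_forall_gt_imp_ge_of_dense
  intro q hq
  exact csInf_le (env_bdd hβ z) (env_interior hf hβ hball hs hs1 hb hq)

lemma env_quasiconvex (hf : QuasiconvexFun f) (hβ : ∀ x, β ≤ f x) (hr : 0 < r)
    (hball : ∀ b : X, ‖b‖ < r → f b ≤ β) : QuasiconvexFun (upperEnv f) := by
  intro x y l hl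
  apply le_of_forall_gt_imp_ge_of_dense
  intro q hq
  rw [max_lt_iff, env_lt_iff hf hβ hr hball, env_lt_iff hf hβ hr hball] at hq
  obtain ⟨⟨p, hp, hx⟩, ⟨p', hp', hy⟩⟩ := hq
  have hm : ∀ p < q, interior {y | f y < p} ⊆ interior {y | f y < q} := fun p hp =>
    interior_mono fun y hy => lt_trans hy hp
  exact csInf_le (env_bdd hβ _) ((hf.convex_lt q).interior (hm p hp hx) (hm p' hp' hy)
    hl.1 (by linarith [hl.2]) (by ring))

lemma env_measurable [MeasurableSpace X] [BorelSpace X]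
    (hf : QuasiconvexFun f) (hβ : ∀ x, β ≤ f x) (hr : 0 < r)
    (hball : ∀ b : X, ‖b‖ < r → f b ≤ β) : Measurable (upperEnv f) := by
  apply measurable_of_Iio
  intro q
  have : upperEnv f ⁻¹' Iio q = ⋃ p ∈ Iio q, interior {y | f y < p} := by
    ext x
    simp [env_lt_iff hf hβ hr hball]
  rw [this]
  exact (isOpen_biUnion fun _ _ => isOpen_interior).measurableSet

/-- the derivative along rational multiples of `ξ` -/
def RatDeriv (G : X → ℝ) (x ξ : X) (a : ℝ) : Prop :=
  Tendsto (fun p : ℚ => (G (x + (p : ℝ) • ξ) - G x) / p) (𝓝[≠] 0) (𝓝 a)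

lemma RatDeriv.smul {G : X → ℝ} {x ξ : X} {a : ℝ} (h : RatDeriv G x ξ a) (c : ℚ) :
    RatDeriv G x ((c : ℝ) • ξ) (c * a) := by
  unfold RatDeriv at *
  rcases eq_or_ne c 0 with rfl | hc
  · simp
  have hcR : (c : ℝ) ≠ 0 := by exact_mod_cast hc
  have ht : Tendsto (fun p : ℚ => p * c) (𝓝[≠] 0) (𝓝[≠] 0) := by
    apply tendsto_nhdsWithin_of_tendsto_nhds_of_eventually_within
    · have : Tendsto (fun p : ℚ => p * c) (𝓝 0) (𝓝 (0 * c)) :=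
        (continuous_id.mul continuous_const).tendsto 0
      rw [zero_mul] at this
      exact this.mono_left nhdsWithin_le_nhds
    · filter_upwards [self_mem_nhdsWithin] with p hp
      exact mul_ne_zero hp hc
  refine ((h.comp ht).const_mul (c : ℝ)).congr' ?_
  filter_upwards [self_mem_nhdsWithin] with p hp
  have hpR : (p : ℝ) ≠ 0 := by exact_mod_cast hp
  simp only [Function.comp, smul_smul]
  push_cast
  field_simp

lemma RatDeriv.quasiconvex {G : X → ℝ} (hG : QuasiconvexFun G) {x ξ η : X} {a b c : ℝ}
    (h : RatDeriv G x ξ a) (h' : RatDeriv G x η b) {l : ℝ} (hl : l ∈ Icc (0:ℝ) 1)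
    (h'' : RatDeriv G x (l • ξ + (1 - l) • η) c) : c ≤ max a b := by
  have hle : (𝓝[>] (0:ℚ)) ≤ 𝓝[≠] 0 := nhdsWithin_mono _ (fun p hp => ne_of_gt hp)
  refine le_of_tendsto_of_tendsto (h''.mono_left hle)
    ((h.mono_left hle).max (h'.mono_left hle)) ?_
  filter_upwards [self_mem_nhdsWithin] with p hp
  have hpR : (0:ℝ) < p := by exact_mod_cast hp
  have := hG (x + (p : ℝ) • ξ) (x + (p : ℝ) • η) l hl
  have e : l • (x + (p : ℝ) • ξ) + (1 - l) • (x + (p : ℝ) • η) =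
    x + (p : ℝ) • (l • ξ + (1 - l) • η) := by module
  rw [e] at this
  rcases le_max_iff.1 this with h | h
  · exact le_max_of_le_left (by gcongr)
  · exact le_max_of_le_right (by gcongr)

lemma RatDeriv.bound {G : X → ℝ} {x ξ : X} {a : ℝ} (h : RatDeriv G x ξ a) {η : ℝ}
    (hη : 0 < η) : ∃ δ : ℝ, 0 < δ ∧ ∀ p : ℚ, 0 < p → (p : ℝ) < δ →
      |G (x + (p : ℝ) • ξ) - G x - p * a| ≤ η * p := by
  have := (Metric.tendsto_nhdsWithin_nhds.1 h) η hη
  obtain ⟨δ, hδ, hh⟩ := this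
  refine ⟨δ, hδ, fun p hp hpδ => ?_⟩
  have hpR : (0:ℝ) < p := by exact_mod_cast hp
  have h1 := hh (x := p) hp.ne' (by
    rw [Rat.dist_eq]
    simpa [abs_of_pos hpR] using hpδ)
  rw [Real.dist_eq] at h1
  have e : G (x + (p : ℝ) • ξ) - G x - p * a =
      ((G (x + (p : ℝ) • ξ) - G x) / p - a) * p := by field_simp
  rw [e, abs_mul, abs_of_pos hpR]
  gcongr

lemma rat_approx {t : ℝ} {P : ℝ → Prop} (hP : ∀ᶠ p in 𝓝 t, P p) {A : ℝ} {F : ℝ → ℝ}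
    (hF : ContinuousAt F t) (h : ∀ p : ℚ, P p → A ≤ F p) : A ≤ F t := by
  by_contra hlt
  push Not at hlt
  have h1 : ∀ᶠ p in 𝓝 t, F p < A := hF.eventually_lt continuousAt_const hlt
  obtain ⟨p, hp⟩ := Rat.denseRange_cast (𝕜 := ℝ) |>.exists_mem_open isOpen_interior
    (⟨t, mem_interior_iff_mem_nhds.2 (hP.and h1)⟩)
  have := interior_subset hp
  exact absurd (h p this.1) (not_le.2 this.2)

end Env

section Ptw
variable {X : Type*} [NormedAddCommGroup X] [NormedSpace ℝ X]
  {f : X → ℝ} {β r : ℝ}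

lemma env_squeeze (hf : QuasiconvexFun f) (hβ : ∀ x, β ≤ f x) (hr : 0 < r)
    (hball : ∀ b : X, ‖b‖ < r → f b ≤ β) {x u ξ : X} {ε η a1 a2 : ℝ} (hε : 0 < ε) (hη : 0 < η)
    (hu : ‖x - u‖ < r / 3) (h1 : RatDeriv (upperEnv f) x (ξ + ε • u) a1)
    (h2 : RatDeriv (upperEnv f) x (ξ - ε • u) a2) :
    ∃ δ : ℝ, 0 < δ ∧ ∀ h : X, ‖h - ξ‖ < ε * r / 3 → ∀ t : ℝ, 0 < t → t < δ →
      f (x + t • h) ≤ upperEnv f x + t * (a1 + η) ∧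
      upperEnv f x + t * (a2 - η) ≤ f (x + t • h) := by
  obtain ⟨δ1, hδ1, hb1⟩ := h1.bound hη
  obtain ⟨δ2, hδ2, hb2⟩ := h2.bound hη
  set M : ℝ := ‖ξ + ε • u‖ + (‖ξ‖ + ε * r / 3) + 1 with hM
  have hMpos : 0 < M := by positivity
  refine ⟨min (min δ1 δ2) (min (1 / ε) (r / 3 / M)), by positivity, ?_⟩
  intro h hh t ht htδ
  rw [lt_min_iff, lt_min_iff, lt_min_iff, lt_div_iff₀ hε, lt_div_iff₀ hMpos] at htδ
  obtain ⟨⟨ht1, ht2⟩, ht3, ht4⟩ := htδ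
  have hte : (t * ε) ≠ 0 := by positivity
  have hsm : ‖ε⁻¹ • (h - ξ)‖ < r / 3 := by
    rw [norm_smul, norm_inv, Real.norm_of_nonneg hε.le, inv_mul_lt_iff₀ hε]
    linarith
  have hhn : ‖h‖ ≤ ‖ξ‖ + ε * r / 3 := by
    have := norm_add_le ξ (h - ξ)
    rw [add_sub_cancel] at this
    linarith
  have hev : ∀ᶠ p in 𝓝 t, 0 < p ∧ p < δ1 ∧ p < δ2 ∧ p * ε < 1 := by
    have e4 : ∀ᶠ p in 𝓝 t, p * ε < 1 :=
      (continuous_id.mul continuous_const).continuousAt.eventually_lt continuousAt_const ht3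
    filter_upwards [eventually_gt_nhds ht, eventually_lt_nhds ht1, eventually_lt_nhds ht2, e4]
      with p a b c d using ⟨a, b, c, d⟩
  constructor
  · have hcont : ContinuousAt (fun p : ℝ => ‖(x + p • (ξ + ε • u)) +
        (p * ε)⁻¹ • ((x + t • h) - (x + p • (ξ + ε • u)))‖) t := by
      have : ContinuousAt (fun p : ℝ => (p * ε)⁻¹) t := ContinuousAt.inv₀ (by fun_prop) hte
      fun_prop
    have hlt : ‖(x + t • (ξ + ε • u)) +
        (t * ε)⁻¹ • ((x + t • h) - (x + t • (ξ + ε • u)))‖ < r := by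
      have e : (x + t • (ξ + ε • u)) +
        (t * ε)⁻¹ • ((x + t • h) - (x + t • (ξ + ε • u))) =
        (x - u) + t • (ξ + ε • u) + ε⁻¹ • (h - ξ) := by
        have e1 : (x + t • h) - (x + t • (ξ + ε • u)) = t • (h - ξ) - (t * ε) • u := by module
        rw [e1, smul_sub, smul_smul, smul_smul, inv_mul_cancel₀ hte, mul_inv, mul_right_comm,
          inv_mul_cancel₀ ht.ne', one_mul]
        module
      rw [e]
      have n1 := norm_add_le ((x - u) + t • (ξ + ε • u)) (ε⁻¹ • (h - ξ))
      have n2 := norm_add_le (x - u) (t • (ξ + ε • u))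
      have n3 : ‖t • (ξ + ε • u)‖ ≤ t * M := by
        rw [norm_smul, Real.norm_of_nonneg ht.le]
        gcongr
        rw [hM]
        have : 0 < ε * r / 3 := by positivity
        linarith [norm_nonneg ξ]
      linarith
    have hev2 := hcont.eventually_lt continuousAt_const hlt
    refine rat_approx (F := fun p => upperEnv f x + p * (a1 + η)) (hev.and hev2) (by fun_prop) ?_
    rintro p ⟨⟨hp0, hp1, _, hp3⟩, hp4⟩
    have := env_le hf hβ hball (mul_pos hp0 hε) hp3.le hp4
    have k1 := le_env hf hβ hr hball (x + t • h)
    have k2 := le_env hf hβ hr hball (x + (p : ℝ) • (ξ + ε • u))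
    have k3 := (abs_le.1 (hb1 p (by exact_mod_cast hp0) hp1)).2
    linarith
  · have hcont : ContinuousAt (fun p : ℝ => ‖(x + t • h) +
        (p * ε)⁻¹ • ((x + p • (ξ - ε • u)) - (x + t • h))‖) t := by
      have : ContinuousAt (fun p : ℝ => (p * ε)⁻¹) t := ContinuousAt.inv₀ (by fun_prop) hte
      fun_prop
    have hlt : ‖(x + t • h) +
        (t * ε)⁻¹ • ((x + t • (ξ - ε • u)) - (x + t • h))‖ < r := by
      have e : (x + t • h) +
        (t * ε)⁻¹ • ((x + t • (ξ - ε • u)) - (x + t • h)) =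
        (x - u) + t • h - ε⁻¹ • (h - ξ) := by
        have e1 : (x + t • (ξ - ε • u)) - (x + t • h) = -(t • (h - ξ)) - (t * ε) • u := by module
        rw [e1, smul_sub, smul_neg, smul_smul, smul_smul, inv_mul_cancel₀ hte, mul_inv,
          mul_right_comm, inv_mul_cancel₀ ht.ne', one_mul]
        module
      rw [e]
      have n1 := norm_sub_le ((x - u) + t • h) (ε⁻¹ • (h - ξ))
      have n2 := norm_add_le (x - u) (t • h)
      have n3 : ‖t • h‖ ≤ t * M := by
        rw [norm_smul, Real.norm_of_nonneg ht.le]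
        gcongr
        rw [hM]
        linarith [norm_nonneg (ξ + ε • u)]
      linarith
    have hev2 := hcont.eventually_lt continuousAt_const hlt
    have := rat_approx (F := fun p => -(upperEnv f x + p * (a2 - η))) (A := - f (x + t • h))
      (hev.and hev2) (by fun_prop) (by
        rintro p ⟨⟨hp0, _, hp1, hp3⟩, hp4⟩
        have := env_le hf hβ hball (mul_pos hp0 hε) hp3.le hp4
        have k3 := (abs_le.1 (hb2 p (by exact_mod_cast hp0) hp1)).1
        linarith)
    linarith

lemma pointwise_diff (hf : QuasiconvexFun f) (hβ : ∀ x, β ≤ f x) (hr : 0 < r)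
    (hball : ∀ b : X, ‖b‖ < r → f b ≤ β) (x : X) (D : Set X) (hD : Dense D)
    (hadd : ∀ v ∈ D, ∀ w ∈ D, v + w ∈ D) (hsm : ∀ (a : ℚ), ∀ v ∈ D, (a : ℝ) • v ∈ D)
    (hder : ∀ ξ ∈ D, ∃ a, RatDeriv (upperEnv f) x ξ a) :
    ContinuousAt f x ∧ ∃ L : X →L[ℝ] ℝ, GateauxDiffAt f x L := by
  have hGq := env_quasiconvex hf hβ hr hball
  choose! q hq using hder
  have hqh : ∀ (a : ℚ), ∀ v ∈ D, q ((a : ℝ) • v) = a * q v := fun a v hv =>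
    tendsto_nhds_unique (hq _ (hsm a v hv)) ((hq v hv).smul a)
  have hqadd : ∀ v ∈ D, ∀ w ∈ D, q (v + w) = q v + q w := by
    apply additive_of_quasiconvex_odd D hadd hsm q hqh
    intro v hv w hw a ha0 ha1
    have hm := hadd _ (hsm a v hv) _ (hsm (1 - a) w hw)
    have := hq _ hm
    push_cast at this ⊢
    exact RatDeriv.quasiconvex hGq (hq v hv) (hq w hw)
      ⟨by exact_mod_cast ha0, by exact_mod_cast ha1⟩ this
  obtain ⟨u, hu, huD⟩ := Metric.dense_iff.1 hD x (r / 3) (by positivity)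
  rw [mem_ball_iff_norm, norm_sub_rev] at hu
  have h0D : (0 : X) ∈ D := by simpa using hsm 0 u huD
  have hq0 : q 0 = 0 := by simpa using hqh 0 u huD
  -- the basic squeeze
  have hsq : ∀ ξ ∈ D, ∀ ε : ℚ, 0 < ε → ∀ η : ℝ, 0 < η → ∃ δ : ℝ, 0 < δ ∧ ∀ h : X,
      ‖h - ξ‖ < ε * r / 3 → ∀ t : ℝ, 0 < t → t < δ →
      |f (x + t • h) - upperEnv f x - t * q ξ| ≤ t * (ε * q u + η) := by
    intro ξ hξ ε hε η hη
    have hεR : (0:ℝ) < ε := by exact_mod_cast hε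
    have e1 : q (ξ + (ε : ℝ) • u) = q ξ + ε * q u := by
      rw [hqadd _ hξ _ (hsm ε u huD), hqh _ _ huD]
    have em : ξ - (ε : ℝ) • u = ξ + ((-ε : ℚ) : ℝ) • u := by
      push_cast
      module
    have e2 : q (ξ - (ε : ℝ) • u) = q ξ - ε * q u := by
      rw [em, hqadd _ hξ _ (hsm (-ε) u huD), hqh _ _ huD]
      push_cast
      ring
    obtain ⟨δ, hδ, hh⟩ := env_squeeze hf hβ hr hball hεR hη hu
      (hq _ (hadd _ hξ _ (hsm ε u huD)))
      (hq (ξ - (ε : ℝ) • u) (by rw [em]; exact hadd _ hξ _ (hsm (-ε) u huD)))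
    refine ⟨δ, hδ, fun h hhξ t ht htδ => ?_⟩
    have := hh h hhξ t ht htδ
    rw [e1, e2] at this
    rw [abs_le]
    constructor <;> nlinarith [this.1, this.2]
  have hqu : 0 ≤ q u := by
    by_contra hneg
    push Not at hneg
    obtain ⟨δ, hδ, hh⟩ := hsq 0 h0D 1 one_pos (-q u / 2) (by linarith)
    have := hh 0 (by simpa using by positivity) (δ / 2) (by positivity) (by linarith)
    have h2 := (abs_nonneg _).trans this
    push_cast at h2
    nlinarith
  have hfx : f x = upperEnv f x := by
    obtain ⟨δ, hδ, hh⟩ := hsq 0 h0D 1 one_pos 1 one_pos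
    have key : ∀ t : ℝ, 0 < t → t < δ → |f x - upperEnv f x| ≤ t * (q u + 1) := by
      intro t ht htδ
      have := hh 0 (by simpa using by positivity) t ht htδ
      simpa [hq0] using this
    by_contra hne
    have hpos : 0 < |f x - upperEnv f x| := abs_pos.2 (sub_ne_zero.2 hne)
    set A := |f x - upperEnv f x|
    have h1 := key (min (δ / 2) (A / (q u + 1) / 2)) (by positivity)
      ((min_le_left _ _).trans_lt (by linarith))
    have h2 : min (δ / 2) (A / (q u + 1) / 2) * (q u + 1) ≤ A / (q u + 1) / 2 * (q u + 1) := by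
      gcongr
      exact min_le_right _ _
    have h3 : A / (q u + 1) / 2 * (q u + 1) = A / 2 := by field_simp
    linarith
  rw [← hfx] at hsq
  constructor
  · rw [Metric.continuousAt_iff]
    intro e he
    obtain ⟨δ, hδ, hh⟩ := hsq 0 h0D 1 one_pos 1 one_pos
    set t := min (δ / 2) (e / (q u + 1) / 2) with ht
    have htpos : 0 < t := by positivity
    refine ⟨t * (r / 3), by positivity, fun y hy => ?_⟩
    rw [dist_eq_norm] at hy
    have := hh (t⁻¹ • (y - x)) (by
      rw [sub_zero, norm_smul, norm_inv, Real.norm_of_nonneg htpos.le, inv_mul_lt_iff₀ htpos]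
      push_cast
      linarith) t htpos ((min_le_left _ _).trans_lt (by linarith))
    rw [smul_smul, mul_inv_cancel₀ htpos.ne', one_smul, add_sub_cancel, hq0] at this
    rw [Real.dist_eq]
    have h2 : t * (q u + 1) ≤ e / (q u + 1) / 2 * (q u + 1) := by
      gcongr
      exact min_le_right _ _
    have h3 : e / (q u + 1) / 2 * (q u + 1) = e / 2 := by field_simp
    push_cast at this
    simp only [mul_zero, sub_zero, one_mul] at this
    linarith
  -- two sided estimate
  have hsq2 : ∀ ξ ∈ D, ∀ ε : ℚ, 0 < ε → ∀ η : ℝ, 0 < η → ∃ δ : ℝ, 0 < δ ∧ ∀ h : X,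
      ‖h - ξ‖ < ε * r / 3 → ∀ t : ℝ, t ≠ 0 → |t| < δ →
      |(f (x + t • h) - f x) / t - q ξ| ≤ ε * q u + η := by
    intro ξ hξ ε hε η hη
    have hnξ : -ξ ∈ D := by simpa using hsm (-1) ξ hξ
    have hqn : q (-ξ) = - q ξ := by simpa using hqh (-1) ξ hξ
    obtain ⟨δ, hδ, hh⟩ := hsq ξ hξ ε hε η hη
    obtain ⟨δ', hδ', hh'⟩ := hsq (-ξ) hnξ ε hε η hη
    refine ⟨min δ δ', by positivity, fun h hhξ t ht0 ht => ?_⟩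
    rw [lt_min_iff] at ht
    have e : (f (x + t • h) - f x) / t - q ξ = (f (x + t • h) - f x - t * q ξ) / t := by
      field_simp
    rw [e, abs_div, div_le_iff₀ (abs_pos.2 ht0), mul_comm _ |t|]
    rcases lt_or_gt_of_ne ht0 with hneg | hpos
    · rw [abs_of_neg hneg] at ht ⊢
      have := hh' (-h) (by
        have e2 : -h - -ξ = -(h - ξ) := by abel
        rwa [e2, norm_neg]) (-t) (by linarith) ht.2
      rw [hqn, smul_neg, neg_smul, neg_neg, neg_mul_neg] at this
      exact this
    · rw [abs_of_pos hpos] at ht ⊢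
      exact hh h hhξ t hpos ht.1
  have hev2 : ∀ h : X, ∀ e : ℝ, 0 < e → ∃ ξ ∈ D, ∀ᶠ t in 𝓝[≠] (0:ℝ),
      |(f (x + t • h) - f x) / t - q ξ| < e := by
    intro h e he
    obtain ⟨ε, hε0, hε1⟩ := exists_rat_btwn (show (0:ℝ) < e / (q u + 1) / 3 by positivity)
    obtain ⟨ξ, hξ, hξD⟩ := Metric.dense_iff.1 hD h (ε * r / 3) (by positivity)
    rw [mem_ball_iff_norm, norm_sub_rev] at hξ
    obtain ⟨δ, hδ, hh⟩ := hsq2 ξ hξD ε (by exact_mod_cast hε0) (e / 3) (by positivity)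
    refine ⟨ξ, hξD, ?_⟩
    have hmem : Metric.ball (0:ℝ) δ ∈ 𝓝[≠] (0:ℝ) :=
      nhdsWithin_le_nhds (Metric.ball_mem_nhds _ hδ)
    filter_upwards [hmem, self_mem_nhdsWithin] with t ht ht0
    have h1 := hh h hξ t ht0 (by simpa using ht)
    have h2 : ε * q u ≤ e / (q u + 1) / 3 * (q u + 1) := by
      gcongr
      linarith
    have h3 : e / (q u + 1) / 3 * (q u + 1) = e / 3 := by field_simp
    linarith
  have hlim : ∀ h : X, ∃ a : ℝ, Tendsto (fun t : ℝ => (f (x + t • h) - f x) / t)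
      (𝓝[≠] 0) (𝓝 a) := by
    intro h
    rw [← cauchy_map_iff_exists_tendsto, Metric.cauchy_iff]
    refine ⟨inferInstance, fun e he => ?_⟩
    obtain ⟨ξ, _, hev⟩ := hev2 h (e / 2) (by positivity)
    refine ⟨Metric.ball (q ξ) (e / 2), ?_, ?_⟩
    · rw [mem_map]
      filter_upwards [hev] with t ht
      simpa [Real.dist_eq] using ht
    · intro a ha b hb
      rw [Metric.mem_ball] at ha hb
      have := dist_triangle_right a b (q ξ)
      linarith
  choose L hL using hlim
  have hLsm : ∀ (c : ℝ) (h : X), L (c • h) = c * L h := by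
    intro c h
    refine tendsto_nhds_unique (hL _) ?_
    rcases eq_or_ne c 0 with rfl | hc
    · simp
    have ht : Tendsto (fun p : ℝ => p * c) (𝓝[≠] 0) (𝓝[≠] 0) := by
      apply tendsto_nhdsWithin_of_tendsto_nhds_of_eventually_within
      · have : Tendsto (fun p : ℝ => p * c) (𝓝 0) (𝓝 (0 * c)) :=
          (continuous_id.mul continuous_const).tendsto 0
        rw [zero_mul] at this
        exact this.mono_left nhdsWithin_le_nhds
      · filter_upwards [self_mem_nhdsWithin] with p hp
        exact mul_ne_zero hp hc
    refine (((hL h).comp ht).const_mul c).congr' ?_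
    filter_upwards [self_mem_nhdsWithin] with p hp
    have hp' : p ≠ 0 := hp
    simp only [Function.comp, smul_smul]
    field_simp
  have hLadd : ∀ v w : X, L (v + w) = L v + L w := by
    intro v w
    refine additive_of_quasiconvex_odd univ (by simp) (by simp) L (fun a v _ => hLsm a v) ?_
      v (mem_univ _) w (mem_univ _)
    intro v _ w _ a ha0 ha1
    have hle : (𝓝[>] (0:ℝ)) ≤ 𝓝[≠] 0 := nhdsWithin_mono _ (fun p hp => ne_of_gt hp)
    refine le_of_tendsto_of_tendsto ((hL _).mono_left hle)
      (((hL v).mono_left hle).max ((hL w).mono_left hle)) ?_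
    filter_upwards [self_mem_nhdsWithin] with p hp
    have hpR : (0:ℝ) < p := hp
    have := hf (x + (p : ℝ) • v) (x + (p : ℝ) • w) a
      ⟨by exact_mod_cast ha0, by exact_mod_cast ha1⟩
    have e : (a : ℝ) • (x + (p : ℝ) • v) + (1 - a : ℝ) • (x + (p : ℝ) • w) =
      x + (p : ℝ) • ((a : ℝ) • v + ((1 - a : ℚ) : ℝ) • w) := by push_cast; module
    rw [e] at this
    rcases le_max_iff.1 this with h | h
    · exact le_max_of_le_left (by gcongr)
    · exact le_max_of_le_right (by gcongr)
  let Llin : X →ₗ[ℝ] ℝ :=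
    { toFun := L
      map_add' := hLadd
      map_smul' := fun c h => hLsm c h }
  have hbound : ∃ C, ∀ z, ‖Llin z‖ ≤ C * ‖z‖ := by
    refine LinearMap.bound_of_ball_bound (r := r / 3) (by positivity) (q u + 1) Llin ?_
    intro z hz
    rw [mem_ball_zero_iff] at hz
    obtain ⟨δ, hδ, hh⟩ := hsq2 0 h0D 1 one_pos 1 one_pos
    have hmem : Metric.ball (0:ℝ) δ ∈ 𝓝[≠] (0:ℝ) :=
      nhdsWithin_le_nhds (Metric.ball_mem_nhds _ hδ)
    refine le_of_tendsto (hL z).norm ?_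
    filter_upwards [hmem, self_mem_nhdsWithin] with t ht ht0
    have := hh z (by push_cast; simpa using hz) t ht0 (by simpa using ht)
    rw [hq0, sub_zero] at this
    push_cast at this
    rw [Real.norm_eq_abs]
    linarith
  exact ⟨Llin.mkContinuousOfExistsBound hbound, fun h => hL h⟩

end Ptw

lemma exists_rat_dense (X : Type*) [NormedAddCommGroup X] [NormedSpace ℝ X]
    [TopologicalSpace.SeparableSpace X] :
    ∃ D : Set X, D.Countable ∧ Dense D ∧ (∀ v ∈ D, ∀ w ∈ D, v + w ∈ D) ∧
      (∀ (a : ℚ), ∀ v ∈ D, (a : ℝ) • v ∈ D) := by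
  let _ : Module ℚ X := Module.compHom X (algebraMap ℚ ℝ)
  have hsmul : ∀ (a : ℚ) (v : X), a • v = (a : ℝ) • v := fun a v => rfl
  let Φ : (ℕ →₀ ℚ) →ₗ[ℚ] X := Finsupp.linearCombination ℚ (TopologicalSpace.denseSeq X)
  refine ⟨range Φ, countable_range _, ?_, ?_, ?_⟩
  · refine (TopologicalSpace.denseRange_denseSeq X).mono ?_
    rintro _ ⟨n, rfl⟩
    exact ⟨Finsupp.single n 1, by simp [Φ]⟩
  · rintro _ ⟨a, rfl⟩ _ ⟨b, rfl⟩
    exact ⟨a + b, map_add _ _ _⟩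
  · rintro c _ ⟨a, rfl⟩
    exact ⟨c • a, by rw [map_smul, hsmul]⟩

lemma lineNull_of_ball {X : Type*} [NormedAddCommGroup X] [NormedSpace ℝ X]
    [TopologicalSpace.SeparableSpace X] [MeasurableSpace X] [BorelSpace X]
    {f : X → ℝ} {β r : ℝ} (hf : QuasiconvexFun f) (hβ : ∀ x, β ≤ f x) (hr : 0 < r)
    (hball : ∀ b : X, ‖b‖ < r → f b ≤ β) :
    LineNull {x : X | ¬ (ContinuousAt f x ∧ ∃ L : X →L[ℝ] ℝ, GateauxDiffAt f x L)} := by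
  obtain ⟨D, hDc, hD, hadd, hsm⟩ := exists_rat_dense X
  have hG := env_measurable hf hβ hr hball
  have hGq := env_quasiconvex hf hβ hr hball
  have : Countable D := hDc.to_subtype
  have hN : ∀ ξ : D, LineNull {x : X | ¬ ∃ a, RatDeriv (upperEnv f) x ξ a} := by
    intro ξ
    refine LineNull.single ?_ (ξ : X) ?_
    · apply MeasurableSet.compl (s := {x : X | ∃ a, RatDeriv (upperEnv f) x ξ a})
      unfold RatDeriv
      apply measurableSet_exists_tendsto
      intro p
      have h1 : Measurable (fun x : X => x + (p : ℝ) • (ξ : X)) :=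
        (continuous_id.add continuous_const).measurable
      exact ((hG.comp h1).sub hG).div_const _
    · intro x
      have hφ : QuasiconvexFun (fun t : ℝ => upperEnv f (x + t • (ξ : X))) := by
        intro s t l hl
        have := hGq (x + s • (ξ : X)) (x + t • (ξ : X)) l hl
        convert this using 2
        simp only [smul_eq_mul]
        module
      have := quasiconvex_real_ae_diff _ hφ
      rw [ae_iff] at this
      refine measure_mono_null ?_ this
      intro t ht hdiff
      apply ht
      refine ⟨deriv (fun t : ℝ => upperEnv f (x + t • (ξ : X))) t, ?_⟩
      have h1 := hdiff.hasDerivAt.tendsto_slope_zero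
      have hc : Tendsto (fun p : ℚ => (p : ℝ)) (𝓝[≠] 0) (𝓝[≠] 0) := by
        apply tendsto_nhdsWithin_of_tendsto_nhds_of_eventually_within
        · have : Tendsto (fun p : ℚ => (p : ℝ)) (𝓝 0) (𝓝 ((0 : ℚ) : ℝ)) :=
            Rat.continuous_coe_real.tendsto 0
          rw [Rat.cast_zero] at this
          exact this.mono_left nhdsWithin_le_nhds
        · filter_upwards [self_mem_nhdsWithin] with p hp
          have : p ≠ 0 := hp
          simpa using this
      refine (h1.comp hc).congr ?_
      intro p
      simp only [Function.comp, smul_eq_mul]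
      rw [div_eq_inv_mul, add_smul, add_assoc]
  refine (LineNull.iUnion hN).mono ?_
  intro x hx
  by_contra hcon
  apply hx
  refine pointwise_diff hf hβ hr hball x D hD hadd hsm ?_
  intro ξ hξ
  by_contra h
  exact hcon (mem_iUnion.2 ⟨⟨ξ, hξ⟩, h⟩)

lemma QuasiconvexFun.max_const {X : Type*} [AddCommGroup X] [Module ℝ X] {f : X → ℝ}
    (hf : QuasiconvexFun f) (m : ℝ) : QuasiconvexFun (fun x => max (f x) m) := by
  intro x y l hl
  have := hf x y l hl
  refine max_le (this.trans ?_) (le_max_of_le_left (le_max_right _ _))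
  exact max_le_max (le_max_left _ _) (le_max_left _ _)

lemma zero_mem_interior_of_symm {X : Type*} [NormedAddCommGroup X] [NormedSpace ℝ X]
    {C : Set X} (hconv : Convex ℝ C) (hsymm : ∀ x ∈ C, -x ∈ C) (hne : (interior C).Nonempty) :
    (0 : X) ∈ interior C := by
  obtain ⟨z, hz⟩ := hne
  have := hconv.combo_interior_self_mem_interior hz (hsymm z (interior_subset hz))
    (a := 1/2) (b := 1/2) (by norm_num) (by norm_num) (by norm_num)
  simpa using this

lemma main_lineNull {X : Type*} [NormedAddCommGroup X] [NormedSpace ℝ X] [CompleteSpace X]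
    [TopologicalSpace.SeparableSpace X] [MeasurableSpace X] [BorelSpace X]
    (f : X → ℝ) (heven : ∀ x : X, f (-x) = f x)
    (hq : QuasiconvexFun f) (hd : DenselyContinuous f) :
    LineNull {x : X | ¬ (ContinuousAt f x ∧ ∃ L : X →L[ℝ] ℝ, GateauxDiffAt f x L)} := by
  have hmin : ∀ x, f 0 ≤ f x := by
    intro x
    have := hq x (-x) (1/2) ⟨by norm_num, by norm_num⟩
    rw [heven, max_self] at this
    convert this using 2
    module
  set m := sInf (f '' {x | ContinuousAt f x}) with hm
  have hbdd : BddBelow (f '' {x | ContinuousAt f x}) := by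
    refine ⟨f 0, ?_⟩
    rintro _ ⟨x, _, rfl⟩
    exact hmin x
  have hne : (f '' {x | ContinuousAt f x}).Nonempty := (Dense.nonempty hd).image f
  have hsymlt : ∀ q, ∀ x ∈ {x | f x < q}, -x ∈ {x | f x < q} := by
    intro q x hx
    change f (-x) < q
    rw [heven]
    exact hx
  have hInterior : ∀ q, m < q → (0 : X) ∈ interior {x | f x < q} := by
    intro q hmq
    apply zero_mem_interior_of_symm (hq.convex_lt q) (hsymlt q)
    obtain ⟨_, ⟨x, hx, rfl⟩, hxq⟩ := exists_lt_of_csInf_lt hne hmq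
    refine ⟨x, mem_interior_iff_mem_nhds.2 ?_⟩
    exact ContinuousAt.eventually_lt hx continuousAt_const hxq
  have hemp : ∀ α, α < m → interior (closure {x | f x < α}) = ∅ := by
    intro α hα
    by_contra hcon
    obtain ⟨x, hxc, hxI⟩ := Dense.exists_mem_open hd isOpen_interior
      (nonempty_iff_ne_empty.2 hcon)
    have hxm : m ≤ f x := csInf_le hbdd ⟨x, hxc, rfl⟩
    have hev : ∀ᶠ y in 𝓝 x, α < f y :=
      continuousAt_const.eventually_lt hxc (hα.trans_le hxm)
    have hfr : ∃ᶠ y in 𝓝 x, f y < α := mem_closure_iff_frequently.1 (interior_subset hxI)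
    obtain ⟨y, hy1, hy2⟩ := (hfr.and_eventually hev).exists
    exact lt_asymm hy1 hy2
  have hconvle : ∀ q, Convex ℝ {x | f x ≤ q} := by
    intro q x hx y hy a b ha hb hab
    have := hq x y a ⟨ha, by linarith⟩
    have e : 1 - a = b := by linarith
    rw [e] at this
    exact this.trans (max_le hx hy)
  have hsymle : ∀ x ∈ {x | f x ≤ m}, -x ∈ {x | f x ≤ m} := by
    intro x hx
    change f (-x) ≤ m
    rw [heven]
    exact hx
  by_cases hT : interior (closure {x | f x ≤ m}) = ∅
  · obtain ⟨E, hE, hEsub, -⟩ := LineNull.exists_span (hconvle m) hsymle hT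
    have hk : ∀ k : ℕ, LineNull {x : X | ¬ (ContinuousAt (fun x => max (f x) (m + 1 / (k + 1))) x ∧
        ∃ L : X →L[ℝ] ℝ, GateauxDiffAt (fun x => max (f x) (m + 1 / (k + 1))) x L)} := by
      intro k
      have hpos : (0:ℝ) < 1 / (k + 1) := by positivity
      obtain ⟨r, hr, hball⟩ := Metric.isOpen_iff.1 isOpen_interior 0
        (hInterior (m + 1 / (k + 1)) (by linarith))
      refine lineNull_of_ball (hq.max_const _) (β := m + 1 / (k + 1)) (r := r)
        (fun x => le_max_right _ _) hr ?_
      intro b hb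
      have : f b < m + 1 / (k + 1) := interior_subset (s := {x | f x < m + 1 / ((k:ℝ) + 1)}) (hball (by simpa using hb))
      exact max_le this.le le_rfl
    refine (hE.union (LineNull.iUnion hk)).mono ?_
    intro x hx
    by_contra hcon
    rw [mem_union, not_or] at hcon
    obtain ⟨hxE, hxk⟩ := hcon
    have hxm : m < f x := by
      by_contra h
      exact hxE (hEsub (subset_closure (not_lt.1 h)))
    obtain ⟨k, hk⟩ := exists_nat_one_div_lt (sub_pos.2 hxm)
    have hgood : ContinuousAt (fun x => max (f x) (m + 1 / (k + 1))) x ∧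
        ∃ L : X →L[ℝ] ℝ, GateauxDiffAt (fun x => max (f x) (m + 1 / (k + 1))) x L := by
      by_contra h
      exact hxk (mem_iUnion.2 ⟨k, h⟩)
    obtain ⟨hc, L, hL⟩ := hgood
    have hev : ∀ᶠ y in 𝓝 x, m + 1 / (k + 1) < max (f y) (m + 1 / (k + 1)) :=
      continuousAt_const.eventually_lt hc (lt_max_of_lt_left (by linarith))
    have hEq : ∀ᶠ y in 𝓝 x, max (f y) (m + 1 / (k + 1)) = f y := by
      filter_upwards [hev] with y hy
      rcases lt_max_iff.1 hy with h | h
      · exact max_eq_left h.le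
      · exact absurd h (lt_irrefl _)
    apply hx
    refine ⟨hc.congr hEq, L, fun h => ?_⟩
    refine (hL h).congr' ?_
    have hl : Tendsto (fun t : ℝ => x + t • h) (𝓝[≠] 0) (𝓝 x) := by
      have : Tendsto (fun t : ℝ => x + t • h) (𝓝 0) (𝓝 (x + (0:ℝ) • h)) :=
        Continuous.tendsto (by fun_prop) 0
      rw [zero_smul, add_zero] at this
      exact this.mono_left nhdsWithin_le_nhds
    filter_upwards [hl.eventually hEq] with t ht
    rw [ht, hEq.self_of_nhds]
  · have hT0 : (0 : X) ∈ interior (closure {x | f x ≤ m}) := by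
      apply zero_mem_interior_of_symm (hconvle m).closure
      · intro x hx
        exact map_mem_closure continuous_neg hx hsymle
      · exact nonempty_iff_ne_empty.2 hT
    obtain ⟨r, hr, hball⟩ := Metric.isOpen_iff.1 isOpen_interior 0 hT0
    have hball2 : ∀ b : X, ‖b‖ < r / 2 → f b ≤ m := by
      intro b hb
      apply le_of_forall_gt_imp_ge_of_dense
      intro p hp
      have h2 : (2:ℝ) • b ∈ closure {x | f x < p} := by
        have : (2:ℝ) • b ∈ closure {x | f x ≤ m} := by
          refine interior_subset (hball ?_)
          rw [mem_ball_zero_iff, norm_smul]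
          norm_num
          linarith
        exact closure_mono (fun y hy => lt_of_le_of_lt hy hp) this
      have := (hq.convex_lt p).combo_interior_closure_mem_interior (hInterior p hp) h2
        (a := 1/2) (b := 1/2) (by norm_num) (by norm_num) (by norm_num)
      rw [smul_zero, zero_add, smul_smul] at this
      norm_num at this
      exact (interior_subset (s := {x | f x < p}) this).le
    have hE : ∀ n : ℕ, ∃ E : Set X, LineNull E ∧ closure {x | f x < m - 1 / (n + 1)} ⊆ E ∧
        ∀ y ∈ {x | f x < m - 1 / (n + 1)}, ∀ z ∈ {x | f x < m - 1 / (n + 1)}, ∀ a b : ℝ,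
          a • y + b • z ∈ E := by
      intro n
      have hpos : (0:ℝ) < 1 / (n + 1) := by positivity
      exact LineNull.exists_span (hq.convex_lt _) (hsymlt _) (hemp _ (by linarith))
    choose E hE hEcl hEcomb using hE
    have hmax := lineNull_of_ball (hq.max_const m) (β := m) (r := r / 2)
      (fun x => le_max_right _ _) (by positivity) (fun b hb => max_le (hball2 b hb) le_rfl)
    refine (hmax.union (LineNull.iUnion hE)).mono ?_
    intro x hx
    by_contra hcon
    rw [mem_union, not_or] at hcon
    obtain ⟨hx1, hx2⟩ := hcon
    obtain ⟨hc, L, hL⟩ := not_not.1 hx1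
    have hxE : ∀ n, x ∉ E n := fun n h => hx2 (mem_iUnion.2 ⟨n, h⟩)
    have hlow : ∀ y, f y < m → ∃ n : ℕ, f y < m - 1 / (n + 1) := by
      intro y hy
      obtain ⟨n, hn⟩ := exists_nat_one_div_lt (sub_pos.2 hy)
      exact ⟨n, by linarith⟩
    have hfx : m ≤ f x := by
      by_contra h
      obtain ⟨n, hn⟩ := hlow x (not_le.1 h)
      exact hxE n (hEcl n (subset_closure hn))
    apply hx
    refine ⟨?_, L, fun h => ?_⟩
    · rw [Metric.continuousAt_iff'] at hc ⊢
      intro e he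
      obtain ⟨n, hn⟩ := exists_nat_one_div_lt (half_pos he)
      have hnb : ∀ᶠ y in 𝓝 x, y ∉ closure {x | f x < m - 1 / ((n:ℝ) + 1)} :=
        isClosed_closure.isOpen_compl.mem_nhds (fun h => hxE n (hEcl n h))
      filter_upwards [hc (e / 2) (by positivity), hnb] with y hy1 hy2
      have hy3 : m - 1 / ((n:ℝ) + 1) ≤ f y := by
        by_contra h
        exact hy2 (subset_closure (not_le.1 h))
      rw [Real.dist_eq, max_eq_left hfx, abs_lt] at hy1
      rw [Real.dist_eq, abs_lt]
      have k1 := le_max_left (f y) m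
      constructor
      · rcases max_cases (f y) m with h | h <;> linarith [hy1.1]
      · linarith [hy1.2]
    · refine (hL h).congr' ?_
      have hsub : {t : ℝ | t ≠ 0 ∧ f (x + t • h) < m}.Subsingleton := by
        rintro s ⟨hs0, hs⟩ t ⟨ht0, ht⟩
        by_contra hst
        obtain ⟨n1, hn1⟩ := hlow _ hs
        obtain ⟨n2, hn2⟩ := hlow _ ht
        have hmono : ∀ n : ℕ, n ≤ max n1 n2 →
            m - 1 / ((n:ℝ) + 1) ≤ m - 1 / (((max n1 n2 : ℕ) : ℝ) + 1) := by
          intro n hn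
          have : (n : ℝ) ≤ ((max n1 n2 : ℕ) : ℝ) := by exact_mod_cast hn
          gcongr
        have hst' : t - s ≠ 0 := sub_ne_zero.2 (Ne.symm hst)
        have := hEcomb (max n1 n2) _ (hn1.trans_le (hmono n1 (le_max_left _ _))) _
          (hn2.trans_le (hmono n2 (le_max_right _ _))) (t / (t - s)) (-s / (t - s))
        apply hxE (max n1 n2)
        convert this using 1
        have e1 : (t / (t - s)) • (x + s • h) + (-s / (t - s)) • (x + t • h) =
          (t / (t - s) + -s / (t - s)) • x + (t / (t - s) * s + -s / (t - s) * t) • h := by module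
        have e2 : t / (t - s) + -s / (t - s) = 1 := by field_simp; ring
        have e3 : t / (t - s) * s + -s / (t - s) * t = 0 := by field_simp; ring
        rw [e1, e2, e3]
        simp
      have hev : ∀ᶠ t in 𝓝[≠] (0:ℝ), t ∉ {t : ℝ | t ≠ 0 ∧ f (x + t • h) < m} :=
        nhdsWithin_le_nhds (hsub.finite.isClosed.isOpen_compl.mem_nhds (fun h => h.1 rfl))
      filter_upwards [hev, self_mem_nhdsWithin] with t ht ht0
      have hmt : m ≤ f (x + t • h) := by
        by_contra hlt
        exact ht ⟨ht0, not_le.1 hlt⟩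
      rw [max_eq_left hmt, max_eq_left hfx]


/-- An even, quasiconvex, densely continuous function on a separable Banach space is
continuous and Gâteaux differentiable on a dense set; if `X` is reflexive, the
exceptional set is contained in a Haar null set. -/
theorem stmt_18 {X : Type*} [NormedAddCommGroup X] [NormedSpace ℝ X] [CompleteSpace X]
    [TopologicalSpace.SeparableSpace X] [MeasurableSpace X] [BorelSpace X]
    (f : X → ℝ) (heven : ∀ x : X, f (-x) = f x)
    (hq : QuasiconvexFun f) (hd : DenselyContinuous f) :
    Dense {x : X | ContinuousAt f x ∧ ∃ L : X →L[ℝ] ℝ, GateauxDiffAt f x L} ∧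
    (IsReflexiveSpace X →
      HaarNull {x : X | ¬ (ContinuousAt f x ∧ ∃ L : X →L[ℝ] ℝ, GateauxDiffAt f x L)}) := by
  have h := main_lineNull f heven hq hd
  refine ⟨?_, fun _ => h.haarNull⟩
  have h2 := h.haarNull.dense_compl
  convert h2 using 1
  ext x
  simp
end
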